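/- Let λ be a partition of r of length n with j ≤ n − m_1(λ), and d = r+n−j. Let F_j(λ) be the set of partitions λ' = [λ_1−ι_1,…,λ_n−ι_n] with ι_i ∈ {0,1}, Σι_i = j, and all λ_i − ι_i ≥ 1. Then set-theoretically the closure of Ψ_{d,r}^{-1}(CH_j(Δ_λ)) equals the union over λ' ∈ F_j(λ) of the dual varieties (Δ_{(λ'_1+1,…,λ'_n+1)})^∨, where (λ'_1+1,…,λ'_n+1) is a partition of d. -/

import Mathlib

open MvPolynomial

noncomputable section

/-- The Zariski closure of a subset of the affine space `σ → K`. -/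
def zClosure {K : Type} [Field K] {σ : Type} [Fintype σ] [DecidableEq σ]
    (S : Set (σ → K)) : Set (σ → K) :=
  {x | ∀ p : MvPolynomial σ K, (∀ y ∈ S, eval y p = 0) → eval x p = 0}

/-- A subset of affine space is Zariski closed if it equals its Zariski closure. -/
def zClosed {K : Type} [Field K] {σ : Type} [Fintype σ] [DecidableEq σ]
    (S : Set (σ → K)) : Prop :=
  zClosure S = S

/-- Irreducibility of a subset of affine space in the Zariski topology,
tested against the basic open sets. -/
def zIrreducible {K : Type} [Field K] {σ : Type} [Fintype σ] [DecidableEq σ]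
    (S : Set (σ → K)) : Prop :=
  S.Nonempty ∧ ∀ p q : MvPolynomial σ K,
    (∀ x ∈ S, eval x p = 0 ∨ eval x q = 0) →
    (∀ x ∈ S, eval x p = 0) ∨ (∀ x ∈ S, eval x q = 0)

/-- There is a strictly increasing chain of `m+1` irreducible Zariski-closed
subsets contained in `S`. -/
def zChain {K : Type} [Field K] {σ : Type} [Fintype σ] [DecidableEq σ]
    (S : Set (σ → K)) (m : ℕ) : Prop :=
  ∃ c : Fin (m+1) → Set (σ → K),
    (∀ i, zIrreducible (c i) ∧ zClosed (c i) ∧ c i ⊆ S) ∧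
    ∀ i j : Fin (m+1), i < j → c i ⊂ c j

/-- `S` has (Krull) dimension `m` in the Zariski topology. -/
def zDimEq {K : Type} [Field K] {σ : Type} [Fintype σ] [DecidableEq σ]
    (S : Set (σ → K)) (m : ℕ) : Prop :=
  zChain S m ∧ ¬ zChain S (m+1)

/-- The (embedded, affine) Zariski tangent space to `S` at `a`: the common kernel of the
differentials at `a` of all polynomials vanishing on `S`. -/
def zTangentAt {K : Type} [Field K] {σ : Type} [Fintype σ] [DecidableEq σ]
    (S : Set (σ → K)) (a : σ → K) : Set (σ → K) :=
  {v | ∀ p : MvPolynomial σ K, (∀ y ∈ S, eval y p = 0) →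
        ∑ i : σ, eval a (pderiv i p) * v i = 0}

/-- Dimension of the Zariski tangent space at a point. -/
def zTangentDim {K : Type} [Field K] {σ : Type} [Fintype σ] [DecidableEq σ]
    (S : Set (σ → K)) (a : σ → K) : ℕ :=
  Module.finrank K (Submodule.span K (zTangentAt S a))

/-- The binary form of degree `r` with coefficient vector `a`. -/
def binForm {K : Type} [CommSemiring K] (r : ℕ) (a : Fin (r+1) → K) :
    MvPolynomial (Fin 2) K :=
  ∑ i : Fin (r+1), C (a i) * X 0 ^ (r - (i : ℕ)) * X 1 ^ (i : ℕ)

/-- The linear binary form `u·x + v·y`. -/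
def linForm {K : Type} [CommSemiring K] (u v : K) : MvPolynomial (Fin 2) K :=
  C u * X 0 + C v * X 1

/-- The affine cone over the coincident root locus `Δ_λ ⊆ ℙ^r`, in coefficient coordinates:
scalar multiples of forms `∏ ℓ_i ^ λ_i`. -/
def crlCone (r n : ℕ) (lam : Fin n → ℕ) : Set (Fin (r+1) → ℂ) :=
  {a | ∃ (t : ℂ) (u v : Fin n → ℂ),
    binForm r a = C t * ∏ i, (linForm (u i) (v i)) ^ lam i}

/-- `lam` is a partition of `r` of length `n` (all parts positive). -/
def isPartitionOf (r n : ℕ) (lam : Fin n → ℕ) : Prop :=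
  (∀ i, 1 ≤ lam i) ∧ ∑ i, lam i = r

/-- The multiplicity `m_j` of the part `j` in the partition `lam`. -/
def multOf {n : ℕ} (lam : Fin n → ℕ) (jj : ℕ) : ℕ :=
  (Finset.univ.filter fun i => lam i = jj).card

/-- The differential operator of degree `s` with coefficient vector `b`, i.e.
`∑ b_i ∂x^(s-i) ∂y^i`, applied to `f`. -/
def diffOp {K : Type} [CommSemiring K] (s : ℕ) (b : Fin (s+1) → K)
    (f : MvPolynomial (Fin 2) K) : MvPolynomial (Fin 2) K :=
  ∑ i : Fin (s+1), b i •
    ((fun g => pderiv (0 : Fin 2) g)^[s - (i : ℕ)]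
      (((fun g => pderiv (1 : Fin 2) g)^[(i : ℕ)]) f))

/-- The apolarity pairing between a degree-`d` operator (coefficients `h`) and a
degree-`d` form (coefficients `a`). -/
def apolarPair (d : ℕ) (h a : Fin (d+1) → ℂ) : ℂ :=
  eval (fun _ => (0 : ℂ)) (diffOp d h (binForm d a))

/-- The cone over the dual variety of the cone `S ⊆ ℂ^(m+1)` (with `k` the dimension of the
cone `S`, used to select smooth points): closure of the set of hyperplanes, written in dual
coordinates via the apolarity pairing, containing an embedded tangent space at a smooth point. -/
def dualConeOf (m : ℕ) (S : Set (Fin (m+1) → ℂ)) (k : ℕ) : Set (Fin (m+1) → ℂ) :=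
  zClosure {h | h ≠ 0 ∧ ∃ a ∈ S, a ≠ 0 ∧ zTangentDim S a = k ∧
      ∀ v ∈ zTangentAt S a, apolarPair m h v = 0}

/-- The row span of a matrix, as a subspace of `ℂ^m`. -/
def rowSpan {k m : ℕ} (M : Matrix (Fin k) (Fin m) ℂ) : Submodule ℂ (Fin m → ℂ) :=
  Submodule.span ℂ (Set.range fun i => M i)

/-- The (redundant) Plücker coordinate vector of the row span of `M`: all maximal minors. -/
def plucker {k m : ℕ} (M : Matrix (Fin k) (Fin m) ℂ) : (Fin k → Fin m) → ℂ :=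
  fun s => (M.submatrix id s).det

/-- The degree-`s` component of the apolar ideal of the degree-`d` form with
coefficients `a`, as a subset of the coefficient space of operators. -/
def apolarSet (d s : ℕ) (a : Fin (d+1) → ℂ) : Set (Fin (s+1) → ℂ) :=
  {b | diffOp s b (binForm d a) = 0}

/-- The (pre-closure) cone, in Plücker coordinates, over the `j`-th higher associated variety
`CH_j(S)`: spans of `k`-row matrices whose row space contains a smooth point `x` of the cone
`S` (`dimS` = dimension of the cone `S`) and meets the tangent space at `x` in projective
dimension at least `j`. -/
def smoothCHCone (m : ℕ) (S : Set (Fin (m+1) → ℂ)) (dimS k j : ℕ) :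
    Set ((Fin k → Fin (m+1)) → ℂ) :=
  {u | ∃ M : Matrix (Fin k) (Fin (m+1)) ℂ, u = plucker M ∧
    Module.finrank ℂ (rowSpan M) = k ∧
    ∃ x, x ≠ 0 ∧ x ∈ S ∧ zTangentDim S x = dimS ∧ x ∈ rowSpan M ∧
      j + 1 ≤ Module.finrank ℂ ↥(rowSpan M ⊓ Submodule.span ℂ (zTangentAt S x))}

/-- The (pre-closure) cone, in Plücker coordinates, over `Ξ_0(S)`: spans of `k`-row matrices
whose row space meets the cone `S` nontrivially. -/
def meetCone (m : ℕ) (S : Set (Fin (m+1) → ℂ)) (k : ℕ) :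
    Set ((Fin k → Fin (m+1)) → ℂ) :=
  {u | ∃ M : Matrix (Fin k) (Fin (m+1)) ℂ, u = plucker M ∧
    Module.finrank ℂ (rowSpan M) = k ∧ ∃ x, x ≠ 0 ∧ x ∈ S ∧ x ∈ rowSpan M}

/-- The preimage under the apolar map `Ψ_{d,s}` of a subset `T` of the Grassmannian
(in Plücker coordinates) of `(k-1)`-projective-dimensional subspaces of `ℙ(D_s)`. -/
def apolarPull (d s k : ℕ) (T : Set ((Fin k → Fin (s+1)) → ℂ)) : Set (Fin (d+1) → ℂ) :=
  {a | ∃ M : Matrix (Fin k) (Fin (s+1)) ℂ,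
    rowSpan M = Submodule.span ℂ (apolarSet d s a) ∧
    Module.finrank ℂ (rowSpan M) = k ∧ plucker M ∈ T}

/-- The Waring rank over `K` of a binary form: the least `r` such that `f` is a sum of `r`
scalar multiples of `d`-th powers of linear forms. -/
def waringRank {K : Type} [Field K] (d : ℕ) (f : MvPolynomial (Fin 2) K) : ℕ :=
  sInf {r | ∃ (α u v : Fin r → K), f = ∑ i, α i • (linForm (u i) (v i)) ^ d}

/-- The set of coefficient vectors of real binary forms of degree `d` of real rank `r`. -/
def realRankSet (d r : ℕ) : Set (Fin (d+1) → ℝ) :=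
  {a | waringRank d (binForm d a) = r}

/-- `R_{d,r}`: the interior, in the Euclidean topology, of the set of real binary forms of
degree `d` and real rank `r`. -/
def Rdr (d r : ℕ) : Set (Fin (d+1) → ℝ) := interior (realRankSet d r)

/-- The topological boundary of `R_{d,r}`: the closure of `R_{d,r}` minus the interior of
the closure. -/
def topBoundary (d r : ℕ) : Set (Fin (d+1) → ℝ) :=
  closure (Rdr d r) \ interior (closure (Rdr d r))

/-- The algebraic boundary `∂_alg(R_{d,r})`: the Zariski closure over `ℂ` of the topological
boundary of `R_{d,r}`. -/
def algBoundary (d r : ℕ) : Set (Fin (d+1) → ℂ) :=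
  zClosure ((fun a i => ((a i : ℝ) : ℂ)) '' topBoundary d r)

lemma val_scale {K : Type} [Field K] (V : ValuationSubring K) (p q : K) (h : p ≠ 0 ∨ q ≠ 0) :
    ∃ c : K, c ≠ 0 ∧ ∃ a b : V, (a : K) = c * p ∧ (b : K) = c * q ∧ (a = 1 ∨ b = 1) := by
  by_cases hv : q = 0
  · have hu : p ≠ 0 := by tauto
    exact ⟨p⁻¹, inv_ne_zero hu, 1, 0, by simp [hu], by simp [hv], Or.inl rfl⟩
  · rcases V.mem_or_inv_mem (p / q) with h | h
    · exact ⟨q⁻¹, inv_ne_zero hv, ⟨_, h⟩, 1, by simp [div_eq_inv_mul], by simp [hv],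
        Or.inr rfl⟩
    · by_cases hu : p = 0
      · exact ⟨q⁻¹, inv_ne_zero hv, 0, 1, by simp [hu], by simp [hv], Or.inr rfl⟩
      · exact ⟨p⁻¹, inv_ne_zero hu, 1, ⟨_, h⟩, by simp [hu], by simp [div_eq_inv_mul],
          Or.inl rfl⟩

lemma elim_aux {σ : Type} [Fintype σ] [DecidableEq σ] {n : ℕ}
    (EE : Set (MvPolynomial (σ ⊕ (Fin n ⊕ Fin n)) ℂ))
    (hom : ∀ E ∈ EE, ∀ (K : Type) [Field K] (g : ℂ →+* K) (x : σ → K) (u v c : Fin n → K),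
      (∀ i, c i ≠ 0) → eval₂ g (Sum.elim x (Sum.elim u v)) E = 0 →
        eval₂ g (Sum.elim x (Sum.elim (fun i => c i * u i) (fun i => c i * v i))) E = 0)
    (p0 : σ → ℂ) (K : Type) [Field K] (ψ : MvPolynomial σ ℂ →+* K)
    (hψ : ∀ a, ψ a = 0 → a ∈ RingHom.ker (eval p0)) (uK vK : Fin n → K)
    (hne : ∀ i, uK i ≠ 0 ∨ vK i ≠ 0)
    (hK : ∀ E ∈ EE, eval₂ (ψ.comp C) (Sum.elim (fun i => ψ (X i)) (Sum.elim uK vK)) E = 0) :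
    ∃ u v : Fin n → ℂ, (∀ i, u i ≠ 0 ∨ v i ≠ 0) ∧
      ∀ E ∈ EE, eval (Sum.elim p0 (Sum.elim u v)) E = 0 := by
  classical
  let m : Ideal (MvPolynomial σ ℂ) := RingHom.ker (eval p0)
  have : m.IsPrime := RingHom.ker_isPrime _
  have hsurj := ψ.rangeRestrict_surjective
  obtain ⟨V, hAV, hIV⟩ := Ideal.image_subset_nonunits_valuationSubring (K := K) (A := ψ.range)
    (m.map ψ.rangeRestrict) (by
      intro h
      rw [Ideal.eq_top_iff_one, Ideal.mem_map_iff_of_surjective _ hsurj] at h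
      obtain ⟨x, hx, hx1⟩ := h
      have h1 : ψ x = 1 := congrArg Subtype.val hx1
      have : x - 1 ∈ m := hψ _ (by simp [h1])
      have h2 : (1 : MvPolynomial σ ℂ) ∈ m := by simpa using m.sub_mem hx this
      exact (Ideal.IsPrime.ne_top ‹_›) ((Ideal.eq_top_iff_one _).2 h2))
  have hV : ∀ p, ψ p ∈ V := fun p => hAV ⟨p, rfl⟩
  let θ : MvPolynomial σ ℂ →+* V := ψ.codRestrict V hV
  let res : V →+* IsLocalRing.ResidueField V := IsLocalRing.residue V
  have hθ : ∀ p ∈ m, res (θ p) = 0 := by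
    intro p hp
    rw [IsLocalRing.residue_eq_zero_iff]
    have : (ψ p) ∈ V.nonunits := hIV ⟨ψ.rangeRestrict p, Ideal.mem_map_of_mem _ hp, rfl⟩
    rw [ValuationSubring.mem_nonunits_iff_exists_mem_maximalIdeal] at this
    obtain ⟨_, h⟩ := this
    exact h
  let g : ℂ →+* V := θ.comp C
  have hscale : ∀ i, ∃ c : K, c ≠ 0 ∧ ∃ a b : V, (a : K) = c * uK i ∧ (b : K) = c * vK i ∧
      (a = 1 ∨ b = 1) := by
    exact fun i => val_scale V (uK i) (vK i) (hne i)
  choose c hc a b ha hb hab using hscale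
  let x : σ → V := fun i => θ (X i)
  have key : ∀ E ∈ EE, eval₂ (res.comp g) (Sum.elim (fun i => res.comp g (p0 i))
      (Sum.elim (fun i => res (a i)) (fun i => res (b i)))) E = 0 := by
    intro E hEE
    have h1 := hK E hEE
    have h2 := hom E hEE K (ψ.comp C) _ uK vK c hc h1
    have h3 : eval₂ g (Sum.elim x (Sum.elim a b)) E = 0 := by
      apply V.subtype_injective
      rw [map_zero, ← h2, eval₂_comp_left]
      congr 1
      funext i
      rcases i with i | i | i
      · rfl
      · exact ha i
      · exact hb i
    have h4 := congrArg res h3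
    rw [map_zero, eval₂_comp_left] at h4
    rw [← h4]
    congr 1
    funext i
    rcases i with i | i | i
    · change res (θ (C (p0 i))) = res (θ (X i))
      rw [← sub_eq_zero, ← map_sub, ← map_sub]
      exact hθ _ (by simp [m, RingHom.mem_ker])
    · rfl
    · rfl
  -- Nullstellensatz
  let sp : MvPolynomial (σ ⊕ (Fin n ⊕ Fin n)) ℂ →+* MvPolynomial (Fin n ⊕ Fin n) ℂ :=
    eval₂Hom C (Sum.elim (fun i => C (p0 i)) X)
  let nz : Fin n → MvPolynomial (Fin n ⊕ Fin n) ℂ := fun i =>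
    if a i = 1 then X (Sum.inl i) - 1 else X (Sum.inr i) - 1
  let I : Ideal (MvPolynomial (Fin n ⊕ Fin n) ℂ) := Ideal.span (sp '' EE ∪ Set.range nz)
  let ev : MvPolynomial (Fin n ⊕ Fin n) ℂ →+* IsLocalRing.ResidueField V :=
    eval₂Hom (res.comp g) (Sum.elim (fun i => res (a i)) (fun i => res (b i)))
  have hI : I ≤ RingHom.ker ev := by
    rw [Ideal.span_le]
    rintro q (⟨E, hEE, rfl⟩ | ⟨i, rfl⟩)
    · rw [SetLike.mem_coe, RingHom.mem_ker]
      rw [← key E hEE]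
      change ev (eval₂ _ _ E) = _
      rw [eval₂_comp_left]
      congr 1
      · ext z; simp [ev]
      · funext i
        rcases i with i | i | i <;> simp [ev]
    · rw [SetLike.mem_coe, RingHom.mem_ker]
      by_cases h : a i = 1
      · simp [nz, ev, h]
      · have := (hab i).resolve_left h
        simp [nz, ev, h, this]
  have hItop : I ≠ ⊤ := fun h => by
    rw [h] at hI
    exact (RingHom.ker_isPrime ev).ne_top (top_le_iff.1 hI)
  have hz : ∃ w : Fin n ⊕ Fin n → ℂ, w ∈ zeroLocus ℂ I := by
    by_contra! h
    have h1 : zeroLocus ℂ I = ∅ := Set.eq_empty_iff_forall_notMem.2 h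
    have h2 := vanishingIdeal_zeroLocus_eq_radical (K := ℂ) I
    rw [h1, vanishingIdeal_empty] at h2
    exact hItop (Ideal.radical_eq_top.1 h2.symm)
  obtain ⟨w, hw⟩ := hz
  refine ⟨fun i => w (Sum.inl i), fun i => w (Sum.inr i), fun i => ?_, fun E hEE => ?_⟩
  · have := hw (nz i) (Ideal.subset_span (Or.inr ⟨i, rfl⟩))
    by_cases h : a i = 1
    · left
      simp [nz, h, sub_eq_zero] at this
      simp [this]
    · right
      simp [nz, h, sub_eq_zero] at this
      simp [this]
  · have := hw (sp E) (Ideal.subset_span (Or.inl ⟨E, hEE, rfl⟩))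
    rw [← this]
    change _ = (aeval w).toRingHom (eval₂ _ _ E)
    rw [eval₂_comp_left, MvPolynomial.eval, coe_eval₂Hom]
    congr 1
    · ext z; simp
    · funext i
      rcases i with i | i | i <;> simp

lemma elim_closed {σ : Type} [Fintype σ] [DecidableEq σ] {n : ℕ}
    (EE : Set (MvPolynomial (σ ⊕ (Fin n ⊕ Fin n)) ℂ))
    (hom : ∀ E ∈ EE, ∀ (K : Type) [Field K] (g : ℂ →+* K) (x : σ → K) (u v c : Fin n → K),
      (∀ i, c i ≠ 0) → eval₂ g (Sum.elim x (Sum.elim u v)) E = 0 →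
        eval₂ g (Sum.elim x (Sum.elim (fun i => c i * u i) (fun i => c i * v i))) E = 0)
    (S : Set (σ → ℂ))
    (hS : ∀ s ∈ S, ∃ u v : Fin n → ℂ, (∀ i, u i ≠ 0 ∨ v i ≠ 0) ∧
      ∀ E ∈ EE, eval (Sum.elim s (Sum.elim u v)) E = 0)
    (p0 : σ → ℂ) (hp : p0 ∈ zClosure S) :
    ∃ u v : Fin n → ℂ, (∀ i, u i ≠ 0 ∨ v i ≠ 0) ∧
      ∀ E ∈ EE, eval (Sum.elim p0 (Sum.elim u v)) E = 0 := by
  classical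
  choose! u v huv hE using hS
  let f : MvPolynomial σ ℂ →+* (S → ℂ) := RingHom.pi fun s => eval s.1
  let m : Ideal (MvPolynomial σ ℂ) := RingHom.ker (eval p0)
  have : m.IsPrime := RingHom.ker_isPrime _
  obtain ⟨P, -, hP, hPm⟩ := Ideal.exists_ideal_comap_le_prime (f := f) m ⊥ (by
    intro p h
    rw [Ideal.mem_comap, Ideal.mem_bot] at h
    exact hp p fun y hy => congrFun h ⟨y, hy⟩)
  let K := FractionRing ((S → ℂ) ⧸ P)
  let φ : (S → ℂ) →+* K := (algebraMap _ K).comp (Ideal.Quotient.mk P)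
  have hφ : ∀ a, φ a = 0 → a ∈ P := by
    intro a ha
    have : algebraMap ((S → ℂ) ⧸ P) K (Ideal.Quotient.mk P a) = 0 := ha
    rw [map_eq_zero_iff _ (IsFractionRing.injective _ _)] at this
    exact Ideal.Quotient.eq_zero_iff_mem.1 this
  let ψ : MvPolynomial σ ℂ →+* K := φ.comp f
  have hψ : ∀ a, ψ a = 0 → a ∈ m := fun a ha => hPm (hφ _ ha)
  refine elim_aux EE hom p0 K ψ hψ (fun i => φ fun s => u s.1 i) (fun i => φ fun s => v s.1 i) ?_ ?_
  · intro i
    by_contra! h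
    have h1 := hφ _ h.1
    have h2 := hφ _ h.2
    apply hP.ne_top
    rw [Ideal.eq_top_iff_one]
    have : (1 : S → ℂ) = (fun s => if u s.1 i = 0 then 0 else (u s.1 i)⁻¹) * (fun s => u s.1 i)
        + (fun s => if u s.1 i = 0 then (v s.1 i)⁻¹ else 0) * (fun s => v s.1 i) := by
      funext s
      have := huv s.1 s.2 i
      by_cases h : u s.1 i = 0
      · simp [h] at this; simp [h, this]
      · simp [h]
    rw [this]
    exact P.add_mem (P.mul_mem_left _ h1) (P.mul_mem_left _ h2)
  · intro E hEE
    have h0 : eval₂ (algebraMap ℂ (S → ℂ)) (Sum.elim (fun i s => s.1 i)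
      (Sum.elim (fun i s => u s.1 i) (fun i s => v s.1 i))) E = 0 := by
      funext s
      have h2 := hE s.1 s.2 E hEE
      have h3 := eval₂_comp_left (Pi.evalRingHom (fun _ : S => ℂ) s) (algebraMap ℂ (S → ℂ))
        (Sum.elim (fun i s => s.1 i)
          (Sum.elim (fun i s => u s.1 i) (fun i s => v s.1 i))) E
      rw [Pi.evalRingHom_apply] at h3
      rw [h3, Pi.zero_apply, ← h2, MvPolynomial.eval, coe_eval₂Hom]
      congr 1
      funext i
      rcases i with i | i | i <;> rfl
    have h3 := eval₂_comp_left φ (algebraMap ℂ (S → ℂ))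
        (Sum.elim (fun i s => s.1 i)
          (Sum.elim (fun i s => u s.1 i) (fun i s => v s.1 i))) E
    rw [h0, map_zero] at h3
    rw [h3]
    congr 1
    · ext z
      change φ (f (C z)) = φ _
      congr 1
      funext s
      change eval s.1 (C z) = z
      simp
    · funext i
      rcases i with i | i | i
      · change φ (f (X i)) = φ _
        congr 1
        funext s
        change eval s.1 (X i) = _
        simp
      · rfl
      · rfl

def pol {N : ℕ} (a : Fin (N+1) → ℂ) : Polynomial ℂ :=
  ∑ i : Fin (N+1), Polynomial.C (a i) * Polynomial.X ^ (i : ℕ)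

def vec (N : ℕ) (p : Polynomial ℂ) : Fin (N+1) → ℂ := fun i => p.coeff i

lemma coeff_pol {N : ℕ} (a : Fin (N+1) → ℂ) (l : ℕ) :
    (pol a).coeff l = if h : l < N + 1 then a ⟨l, h⟩ else 0 := by
  simp only [pol, Polynomial.finsetSum_coeff, Polynomial.coeff_C_mul, Polynomial.coeff_X_pow]
  split_ifs with h
  · rw [Finset.sum_eq_single ⟨l, h⟩]
    · simp
    · intro b _ hb
      have : l ≠ b := fun h' => hb (Fin.ext h'.symm)
      simp [this]
    · simp
  · apply Finset.sum_eq_zero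
    intro b _
    have : l ≠ b := by have := b.2; omega
    simp [this]

lemma vec_pol {N : ℕ} (a : Fin (N+1) → ℂ) : vec N (pol a) = a := by
  funext i
  rw [vec, coeff_pol, dif_pos i.2]

lemma natDegree_pol_le {N : ℕ} (a : Fin (N+1) → ℂ) : (pol a).natDegree ≤ N := by
  rw [Polynomial.natDegree_le_iff_coeff_eq_zero]
  intro l hl
  rw [coeff_pol, dif_neg (by omega)]

lemma pol_vec {N : ℕ} {p : Polynomial ℂ} (hp : p.natDegree ≤ N) : pol (vec N p) = p := by
  ext l
  rw [coeff_pol]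
  split_ifs with h
  · rfl
  · rw [Polynomial.coeff_eq_zero_of_natDegree_lt (by omega)]

lemma pol_injective {N : ℕ} : Function.Injective (pol (N := N)) :=
  Function.LeftInverse.injective vec_pol

def polL (N : ℕ) : (Fin (N+1) → ℂ) →ₗ[ℂ] Polynomial ℂ where
  toFun := pol
  map_add' a b := by simp [pol, add_mul, Finset.sum_add_distrib]
  map_smul' c a := by
    simp only [pol, Pi.smul_apply, smul_eq_mul, map_mul, RingHom.id_apply, Finset.smul_sum,
      Polynomial.smul_eq_C_mul, mul_assoc]

def vecL (N : ℕ) : Polynomial ℂ →ₗ[ℂ] (Fin (N+1) → ℂ) where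
  toFun := vec N
  map_add' a b := by funext i; simp [vec]
  map_smul' c a := by funext i; simp [vec]

def lin (u v : ℂ) : Polynomial ℂ := Polynomial.C u + Polynomial.C v * Polynomial.X

def prodL {n : ℕ} (lam : Fin n → ℕ) (u v : Fin n → ℂ) : Polynomial ℂ :=
  ∏ i, lin (u i) (v i) ^ lam i

lemma natDegree_lin_le (u v : ℂ) : (lin u v).natDegree ≤ 1 := by
  unfold lin
  compute_degree

lemma lin_ne_zero {u v : ℂ} (h : u ≠ 0 ∨ v ≠ 0) : lin u v ≠ 0 := by
  intro h0
  have h1 := congrArg (fun p => Polynomial.coeff p 0) h0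
  have h2 := congrArg (fun p => Polynomial.coeff p 1) h0
  simp [lin] at h1 h2
  simp [h1, h2] at h

lemma natDegree_prodL_le {n : ℕ} (lam : Fin n → ℕ) (u v : Fin n → ℂ) :
    (prodL lam u v).natDegree ≤ ∑ i, lam i := by
  unfold prodL
  refine (Polynomial.natDegree_prod_le _ _).trans (Finset.sum_le_sum fun i _ => ?_)
  refine (Polynomial.natDegree_pow_le).trans ?_
  calc lam i * _ ≤ lam i * 1 := Nat.mul_le_mul_left _ (natDegree_lin_le _ _)
    _ = _ := mul_one _

lemma prodL_ne_zero {n : ℕ} (lam : Fin n → ℕ) {u v : Fin n → ℂ} (h : ∀ i, u i ≠ 0 ∨ v i ≠ 0) :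
    prodL lam u v ≠ 0 :=
  Finset.prod_ne_zero_iff.2 fun i _ => pow_ne_zero _ (lin_ne_zero (h i))

def dehom : MvPolynomial (Fin 2) ℂ →ₐ[ℂ] Polynomial ℂ := aeval ![1, Polynomial.X]

lemma dehom_binForm {r : ℕ} (a : Fin (r+1) → ℂ) : dehom (binForm r a) = pol a := by
  simp [dehom, binForm, pol, algebraMap_eq]

lemma dehom_prod {n : ℕ} (lam : Fin n → ℕ) (t : ℂ) (u v : Fin n → ℂ) :
    dehom (C t * ∏ i, (linForm (u i) (v i)) ^ lam i) = Polynomial.C t * prodL lam u v := by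
  simp [dehom, prodL, linForm, lin, algebraMap_eq]

lemma binForm_homog {r : ℕ} (a : Fin (r+1) → ℂ) : (binForm r a).IsHomogeneous r := by
  unfold binForm
  refine IsHomogeneous.sum _ _ _ fun i _ => ?_
  have h := (((isHomogeneous_C (Fin 2) (a i)).mul ((isHomogeneous_X ℂ (0 : Fin 2)).pow (r - i))).mul
    ((isHomogeneous_X ℂ (1 : Fin 2)).pow (i : ℕ)))
  have e : 0 + 1 * (r - (i : ℕ)) + 1 * i = r := by have := i.2; omega
  rwa [e] at h

lemma dehom_inj {r : ℕ} {F G : MvPolynomial (Fin 2) ℂ} (hF : F.IsHomogeneous r)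
    (hG : G.IsHomogeneous r) (h : dehom F = dehom G) : F = G := by
  have key : ∀ {H : MvPolynomial (Fin 2) ℂ}, H.IsHomogeneous r →
      (rename (Equiv.swap (0 : Fin 2) 1) H) = (dehom H).homogenize r := by
    intro H hH
    refine (Polynomial.homogenize_eq_of_isHomogeneous (hH.rename_isHomogeneous) ?_).symm
    rw [aeval_rename]
    unfold dehom
    congr 2
    funext i
    fin_cases i <;> rfl
  apply rename_injective _ (Equiv.swap (0 : Fin 2) 1).injective
  rw [key hF, key hG, h]

lemma crl_iff {r n : ℕ} {lam : Fin n → ℕ} (hl : ∑ i, lam i = r) (a : Fin (r+1) → ℂ) :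
    a ∈ crlCone r n lam ↔ ∃ (t : ℂ) (u v : Fin n → ℂ), pol a = Polynomial.C t * prodL lam u v := by
  constructor
  · rintro ⟨t, u, v, h⟩
    exact ⟨t, u, v, by rw [← dehom_binForm, h, dehom_prod]⟩
  · rintro ⟨t, u, v, h⟩
    refine ⟨t, u, v, dehom_inj (binForm_homog a) ?_ (by rw [dehom_binForm, h, dehom_prod])⟩
    have h1 : (∏ i, (linForm (u i) (v i)) ^ lam i).IsHomogeneous (∑ i, lam i) := by
      refine IsHomogeneous.prod _ _ _ fun i _ => ?_
      have : (linForm (u i) (v i)).IsHomogeneous 1 := by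
        unfold linForm
        have h0 := (isHomogeneous_C (Fin 2) (u i)).mul (isHomogeneous_X ℂ (0 : Fin 2))
        have h1 := (isHomogeneous_C (Fin 2) (v i)).mul (isHomogeneous_X ℂ (1 : Fin 2))
        exact h0.add h1
      simpa using this.pow (lam i)
    have := (isHomogeneous_C (Fin 2) t).mul h1
    rwa [hl, zero_add] at this

/-- the apolarity functional -/
def Lf (d : ℕ) (a : Fin (d+1) → ℂ) : Polynomial ℂ →ₗ[ℂ] ℂ :=
  ∑ l : Fin (d+1), (a l * ((d - l : ℕ).factorial * (l : ℕ).factorial : ℕ)) • Polynomial.lcoeff ℂ l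

lemma Lf_apply (d : ℕ) (a : Fin (d+1) → ℂ) (p : Polynomial ℂ) :
    Lf d a p = ∑ l : Fin (d+1), (a l * ((d - l : ℕ).factorial * (l : ℕ).factorial : ℕ)) * p.coeff l := by
  simp [Lf]

lemma Lf_X_pow (d : ℕ) (a : Fin (d+1) → ℂ) (l : ℕ) (hl : l < d + 1) :
    Lf d a (Polynomial.X ^ l) = a ⟨l, hl⟩ * ((d - l : ℕ).factorial * (l : ℕ).factorial : ℕ) := by
  rw [Lf_apply, Finset.sum_eq_single ⟨l, hl⟩]
  · simp
  · intro b _ hb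
    have : (b : ℕ) ≠ l := fun h' => hb (Fin.ext h')
    simp [Polynomial.coeff_X_pow, this]
  · simp

lemma Lf_pol_mul (d s : ℕ) (a : Fin (d+1) → ℂ) (b : Fin (s+1) → ℂ) (q : Polynomial ℂ) :
    Lf d a (pol b * q) = ∑ i : Fin (s+1), b i * Lf d a (Polynomial.X ^ (i : ℕ) * q) := by
  rw [pol, Finset.sum_mul, map_sum]
  refine Finset.sum_congr rfl fun i _ => ?_
  rw [mul_assoc, ← Polynomial.smul_eq_C_mul, map_smul, smul_eq_mul]

lemma coeff_pderiv_iter (i : Fin 2) (p : ℕ) (f : MvPolynomial (Fin 2) ℂ) (e : Fin 2 →₀ ℕ) :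
    coeff e ((fun g => pderiv i g)^[p] f) =
      coeff (e + Finsupp.single i p) f * ((e i + p).descFactorial p : ℕ) := by
  induction p generalizing f e with
  | zero => simp
  | succ p ih =>
    rw [Function.iterate_succ_apply, ih, coeff_pderiv, add_assoc, ← Finsupp.single_add, mul_assoc]
    congr 1
    rw [← add_assoc, Nat.succ_descFactorial_succ]
    simp

lemma coeff_binForm (d : ℕ) (a : Fin (d+1) → ℂ) (e : Fin 2 →₀ ℕ) :
    coeff e (binForm d a) = if e 0 + e 1 = d then (pol a).coeff (e 1) else 0 := by
  have h1 : ∀ i : Fin (d+1), C (a i) * X 0 ^ (d - (i : ℕ)) * X 1 ^ (i : ℕ) =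
      monomial (Finsupp.single 0 (d - (i : ℕ)) + Finsupp.single (1 : Fin 2) (i : ℕ)) (a i) := by
    intro i
    rw [X_pow_eq_monomial, X_pow_eq_monomial, C_mul_monomial, monomial_mul]
    simp
  have h2 : ∀ i : Fin (d+1), (Finsupp.single (0 : Fin 2) (d - (i : ℕ)) + Finsupp.single (1 : Fin 2) (i : ℕ) = e)
      ↔ (e 0 + e 1 = d ∧ e 1 = i) := by
    intro i
    rw [Finsupp.ext_iff]
    simp [Fin.forall_fin_two]
    have := i.2
    omega
  rw [binForm]
  simp only [h1, coeff_sum, coeff_monomial, h2]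
  split_ifs with h
  · rw [coeff_pol]
    simp only [h, true_and]
    rw [dif_pos (by omega)]
    rw [Finset.sum_eq_single ⟨e 1, by omega⟩]
    · simp
    · intro b _ hb
      have : ¬ (e 1 = b) := fun h' => hb (Fin.ext h'.symm)
      simp [this]
    · simp
  · simp [h]

lemma coeff_diffOp (d s : ℕ) (b : Fin (s+1) → ℂ) (a : Fin (d+1) → ℂ) (e : Fin 2 →₀ ℕ)
    (he : e 0 + e 1 + s = d) :
    coeff e (diffOp s b (binForm d a)) * ((e 0).factorial * (e 1).factorial : ℕ) =
      Lf d a (pol b * Polynomial.X ^ (e 1)) := by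
  rw [Lf_pol_mul, diffOp, coeff_sum, Finset.sum_mul]
  refine Finset.sum_congr rfl fun i _ => ?_
  have hi := i.2
  have k0 : (e + Finsupp.single (0 : Fin 2) (s - (i : ℕ)) + Finsupp.single 1 (i : ℕ) : Fin 2 →₀ ℕ) 0 = e 0 + (s - i) := by
    simp only [Finsupp.add_apply, Finsupp.single_apply]; simp
  have k1 : (e + Finsupp.single (0 : Fin 2) (s - (i : ℕ)) + Finsupp.single 1 (i : ℕ) : Fin 2 →₀ ℕ) 1 = e 1 + i := by
    simp only [Finsupp.add_apply, Finsupp.single_apply]; simp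
  have k2 : (e + Finsupp.single (0 : Fin 2) (s - (i : ℕ)) : Fin 2 →₀ ℕ) 1 = e 1 := by
    simp only [Finsupp.add_apply, Finsupp.single_apply]; simp
  have hX : Lf d a (Polynomial.X ^ (e 1 + (i : ℕ))) = (pol a).coeff (e 1 + i) *
      ((d - (e 1 + i) : ℕ).factorial * (e 1 + i : ℕ).factorial : ℕ) := by
    rw [Lf_X_pow _ _ _ (by omega), coeff_pol, dif_pos (by omega)]
  rw [coeff_smul, coeff_pderiv_iter, coeff_pderiv_iter, coeff_binForm, smul_eq_mul, ← pow_add,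
    add_comm (i : ℕ) (e 1), hX, k0, k1, k2, if_pos (by omega)]
  have f0 := Nat.factorial_mul_descFactorial (n := e 0 + (s - i)) (k := s - i) (by omega)
  have f1 := Nat.factorial_mul_descFactorial (n := e 1 + i) (k := i) (by omega)
  have g0 : e 0 + (s - i) - (s - i) = e 0 := by omega
  have g1 : e 1 + i - i = e 1 := by omega
  rw [g0] at f0
  rw [g1] at f1
  have g2 : d - (e 1 + i) = e 0 + (s - i) := by omega
  rw [g2, ← f0, ← f1]
  push_cast
  ring

lemma coeff_diffOp_zero (d s : ℕ) (b : Fin (s+1) → ℂ) (a : Fin (d+1) → ℂ) (e : Fin 2 →₀ ℕ)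
    (he : e 0 + e 1 + s ≠ d) :
    coeff e (diffOp s b (binForm d a)) = 0 := by
  rw [diffOp, coeff_sum]
  refine Finset.sum_eq_zero fun i _ => ?_
  have hi := i.2
  rw [coeff_smul, coeff_pderiv_iter, coeff_pderiv_iter, coeff_binForm, if_neg (by simp; omega)]
  simp

lemma mem_apolarSet_iff {d s : ℕ} (hs : s ≤ d) (b : Fin (s+1) → ℂ) (a : Fin (d+1) → ℂ) :
    b ∈ apolarSet d s a ↔ ∀ m ≤ d - s, Lf d a (pol b * Polynomial.X ^ m) = 0 := by
  constructor
  · intro h m hm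
    have := coeff_diffOp d s b a (Finsupp.single 0 (d - s - m) + Finsupp.single 1 m) (by simp; omega)
    have h' : diffOp s b (binForm d a) = 0 := h
    rw [h'] at this
    simpa using this.symm
  · intro h
    show diffOp s b (binForm d a) = 0
    ext e
    by_cases he : e 0 + e 1 + s = d
    · have := coeff_diffOp d s b a e he
      rw [h _ (by omega)] at this
      have h3 : (((e 0).factorial * (e 1).factorial : ℕ) : ℂ) ≠ 0 := by
        exact_mod_cast Nat.mul_ne_zero (Nat.factorial_ne_zero _) (Nat.factorial_ne_zero _)
      simpa using (mul_eq_zero.1 this).resolve_right h3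
    · rw [coeff_diffOp_zero d s b a e he, coeff_zero]

lemma Lf_mul_sum {d : ℕ} (a : Fin (d+1) → ℂ) (p c : Polynomial ℂ) (N : ℕ) (hc : c.natDegree ≤ N)
    (h : ∀ m ≤ N, Lf d a (p * Polynomial.X ^ m) = 0) : Lf d a (p * c) = 0 := by
  rw [c.as_sum_range' (N+1) (by omega), Finset.mul_sum, map_sum]
  refine Finset.sum_eq_zero fun i hi => ?_
  rw [← Polynomial.C_mul_X_pow_eq_monomial, mul_left_comm, ← Polynomial.smul_eq_C_mul, map_smul,
    h i (by simpa using Nat.lt_succ_iff.1 (Finset.mem_range.1 hi)), smul_zero]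

lemma mem_apolarSet_iff' {d s : ℕ} (hs : s ≤ d) (b : Fin (s+1) → ℂ) (a : Fin (d+1) → ℂ) :
    b ∈ apolarSet d s a ↔ ∀ c : Polynomial ℂ, c.natDegree ≤ d - s → Lf d a (pol b * c) = 0 := by
  rw [mem_apolarSet_iff hs]
  constructor
  · intro h c hc
    exact Lf_mul_sum a _ c _ hc h
  · intro h m hm
    exact h _ (by simpa using hm)

lemma apolarPair_eq {d : ℕ} (h a : Fin (d+1) → ℂ) : apolarPair d h a = Lf d h (pol a) := by
  have := coeff_diffOp d d h a 0 (by simp)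
  simp at this
  rw [apolarPair]
  have e : (fun _ => (0:ℂ) : Fin 2 → ℂ) = 0 := rfl
  rw [e]
  have h1 : eval (0 : Fin 2 → ℂ) (diffOp d h (binForm d a)) = coeff 0 (diffOp d h (binForm d a)) := by
    rw [← constantCoeff_eq, eval_zero]
  rw [h1, this, Lf_apply, Lf_apply]
  refine Finset.sum_congr rfl fun l _ => ?_
  rw [coeff_pol, coeff_pol, dif_pos l.2, dif_pos l.2]
  ring

/-- one-variable polynomial functions -/
def P1 : Subalgebra ℂ (ℂ → ℂ) := (Polynomial.aeval (R := ℂ) (fun s : ℂ => s)).range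

lemma mem_P1 {f : ℂ → ℂ} : f ∈ P1 ↔ ∃ p : Polynomial ℂ, ∀ s, f s = p.eval s := by
  have key : ∀ (p : Polynomial ℂ) (s : ℂ), (Polynomial.aeval (R := ℂ) (fun s : ℂ => s) p) s = p.eval s := by
    intro p s
    have := Polynomial.aeval_algHom_apply (Pi.evalAlgHom ℂ (fun _ : ℂ => ℂ) s) (fun s : ℂ => s) p
    simp only [Pi.evalAlgHom_apply] at this
    rw [← this, Polynomial.coe_aeval_eq_eval]
  constructor
  · rintro ⟨p, rfl⟩
    exact ⟨p, key p⟩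
  · rintro ⟨p, h⟩
    exact ⟨p, funext fun s => by rw [h]; exact key p s⟩

lemma P1_const (c : ℂ) : (fun _ : ℂ => c) ∈ P1 := mem_P1.2 ⟨Polynomial.C c, by simp⟩

lemma P1_id : (fun s : ℂ => s) ∈ P1 := mem_P1.2 ⟨Polynomial.X, by simp⟩

lemma P1_add {f g : ℂ → ℂ} (hf : f ∈ P1) (hg : g ∈ P1) : (fun s => f s + g s) ∈ P1 := P1.add_mem hf hg
lemma P1_sub {f g : ℂ → ℂ} (hf : f ∈ P1) (hg : g ∈ P1) : (fun s => f s - g s) ∈ P1 := P1.sub_mem hf hg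
lemma P1_mul {f g : ℂ → ℂ} (hf : f ∈ P1) (hg : g ∈ P1) : (fun s => f s * g s) ∈ P1 := P1.mul_mem hf hg
lemma P1_sum {κ : Type*} (t : Finset κ) {f : κ → ℂ → ℂ} (hf : ∀ k ∈ t, f k ∈ P1) :
    (fun s => ∑ k ∈ t, f k s) ∈ P1 := by
  have : (fun s => ∑ k ∈ t, f k s) = ∑ k ∈ t, f k := by funext s; simp
  rw [this]; exact sum_mem hf
lemma P1_prod {κ : Type*} (t : Finset κ) {f : κ → ℂ → ℂ} (hf : ∀ k ∈ t, f k ∈ P1) :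
    (fun s => ∏ k ∈ t, f k s) ∈ P1 := by
  have : (fun s => ∏ k ∈ t, f k s) = ∏ k ∈ t, f k := by funext s; simp
  rw [this]; exact prod_mem hf

lemma P1_line (a b : ℂ) : (fun s : ℂ => (1 - s) * a + s * b) ∈ P1 :=
  P1_add (P1_mul (P1_sub (P1_const 1) P1_id) (P1_const a)) (P1_mul P1_id (P1_const b))

lemma P1_eval {σ : Type*} (x : ℂ → σ → ℂ) (hx : ∀ i, (fun s => x s i) ∈ P1) (Q : MvPolynomial σ ℂ) :
    (fun s => eval (x s) Q) ∈ P1 := by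
  induction Q using MvPolynomial.induction_on with
  | C a => simpa using P1_const a
  | add p q hp hq => simpa using P1_add hp hq
  | mul_X p i hp => simpa using P1_mul hp (hx i)

lemma P1_det {κ : Type*} [Fintype κ] [DecidableEq κ] (A : ℂ → Matrix κ κ ℂ)
    (h : ∀ i j, (fun s => A s i j) ∈ P1) : (fun s => (A s).det) ∈ P1 := by
  simp only [Matrix.det_apply']
  refine P1_sum _ fun σ _ => P1_mul (P1_const _) (P1_prod _ fun i _ => h _ _)

lemma P1_dense {f g : ℂ → ℂ} (hf : f ∈ P1) (hg : g ∈ P1) (s1 : ℂ) (h1 : g s1 ≠ 0)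
    (h : ∀ s, g s ≠ 0 → f s = 0) (s : ℂ) : f s = 0 := by
  obtain ⟨p, hp⟩ := mem_P1.1 hf
  obtain ⟨q, hq⟩ := mem_P1.1 hg
  have h0 : p * q = 0 := by
    apply Polynomial.funext
    intro s
    by_cases hs : q.eval s = 0
    · simp [hs]
    · have := h s (by rwa [hq])
      rw [hp] at this
      simp [this]
  have hq0 : q ≠ 0 := by rintro rfl; simp [hq] at h1
  rw [hp, (mul_eq_zero.1 h0).resolve_right hq0, Polynomial.eval_zero]

/-- curves of polynomials with polynomial coefficients -/
def PC (f : ℂ → Polynomial ℂ) : Prop := ∀ l, (fun s => (f s).coeff l) ∈ P1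

lemma PC_const (c : Polynomial ℂ) : PC fun _ => c := fun l => P1_const _
lemma PC_mul {f g : ℂ → Polynomial ℂ} (hf : PC f) (hg : PC g) : PC fun s => f s * g s := by
  intro l
  simp only [Polynomial.coeff_mul]
  exact P1_sum _ fun x _ => P1_mul (hf _) (hg _)
lemma PC_prod {κ : Type*} (t : Finset κ) {f : κ → ℂ → Polynomial ℂ} (hf : ∀ k ∈ t, PC (f k)) :
    PC fun s => ∏ k ∈ t, f k s := by
  classical
  induction t using Finset.induction_on with
  | empty => simpa using PC_const 1
  | insert a t ha ih =>
    simp only [Finset.prod_insert ha]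
    exact PC_mul (hf _ (by simp)) (ih fun k hk => hf k (by simp [hk]))
lemma PC_pow {f : ℂ → Polynomial ℂ} (hf : PC f) (m : ℕ) : PC fun s => f s ^ m := by
  induction m with
  | zero => simpa using PC_const 1
  | succ m ih => simp only [pow_succ]; exact PC_mul ih hf
lemma PC_C {f : ℂ → ℂ} (hf : f ∈ P1) : PC fun s => Polynomial.C (f s) := by
  intro l
  simp only [Polynomial.coeff_C]
  split_ifs
  · exact hf
  · exact P1_const 0
lemma PC_lin {f g : ℂ → ℂ} (hf : f ∈ P1) (hg : g ∈ P1) : PC fun s => lin (f s) (g s) := by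
  intro l
  simp only [lin, Polynomial.coeff_add]
  exact P1_add (PC_C hf l) (PC_mul (PC_C hg) (PC_const Polynomial.X) l)
lemma PC_prodL {n : ℕ} (lam : Fin n → ℕ) {u v : ℂ → Fin n → ℂ} (hu : ∀ i, (fun s => u s i) ∈ P1)
    (hv : ∀ i, (fun s => v s i) ∈ P1) : PC fun s => prodL lam (u s) (v s) :=
  PC_prod _ fun i _ => PC_pow (PC_lin (hu i) (hv i)) _

/-- coefficientwise derivatives -/
def PD (f : ℂ → Polynomial ℂ) (f' : Polynomial ℂ) (s : ℂ) : Prop :=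
  ∀ l, HasDerivAt (fun s => (f s).coeff l) (f'.coeff l) s
lemma PD_mul_const {f : ℂ → Polynomial ℂ} {f' : Polynomial ℂ} {s : ℂ} (hf : PD f f' s) (g : Polynomial ℂ) :
    PD (fun s => g * f s) (g * f') s := by
  intro l
  simp only [Polynomial.coeff_mul]
  exact HasDerivAt.fun_sum fun x _ => (hf _).const_mul _
lemma PD_mul {f g : ℂ → Polynomial ℂ} {f' g' : Polynomial ℂ} {s : ℂ} (hf : PD f f' s) (hg : PD g g' s) :
    PD (fun s => f s * g s) (f' * g s + f s * g') s := by
  intro l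
  simp only [Polynomial.coeff_mul, Polynomial.coeff_add]
  rw [← Finset.sum_add_distrib]
  exact HasDerivAt.fun_sum fun x _ => (hf _).mul (hg _)
lemma PD_pow {f : ℂ → Polynomial ℂ} {f' : Polynomial ℂ} {s : ℂ} (hf : PD f f' s) (m : ℕ) :
    PD (fun s => f s ^ (m+1)) ((m+1 : ℕ) * (f s ^ m * f')) s := by
  induction m with
  | zero => simpa using hf
  | succ m ih =>
    have := PD_mul ih hf
    simp only [← pow_succ] at this
    convert this using 1
    push_cast
    ring

lemma eval_hasDerivAt {σ : Type*} [Fintype σ] (x : ℂ → σ → ℂ) (x' : σ → ℂ) (s : ℂ)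
    (hx : ∀ i, HasDerivAt (fun s => x s i) (x' i) s) (Q : MvPolynomial σ ℂ) :
    HasDerivAt (fun s => eval (x s) Q) (∑ i, eval (x s) (pderiv i Q) * x' i) s := by
  classical
  induction Q using MvPolynomial.induction_on with
  | C a => simpa using hasDerivAt_const s a
  | add p q hp hq =>
    simp only [map_add, add_mul, Finset.sum_add_distrib]
    exact hp.add hq
  | mul_X p i hp =>
    simp only [map_mul, eval_X]
    refine (hp.fun_mul (hx i)).congr_deriv (Eq.symm ?_)
    simp only [Derivation.leibniz, smul_eq_mul, map_add, map_mul, eval_X, pderiv_X, add_mul,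
      Finset.sum_add_distrib, Finset.sum_mul]
    rw [add_comm]
    congr 1
    · exact Finset.sum_congr rfl fun k _ => by ring
    · rw [Finset.sum_eq_single i]
      · simp
      · intro b _ hb
        simp [Pi.single_apply, hb.symm]
      · simp

/-- differential of `P` at `a` as a functional on polynomials -/
def dif {r : ℕ} (P : MvPolynomial (Fin (r+1)) ℂ) (a : Fin (r+1) → ℂ) : Polynomial ℂ →ₗ[ℂ] ℂ :=
  ∑ l : Fin (r+1), eval a (pderiv l P) • Polynomial.lcoeff ℂ l

lemma dif_apply {r : ℕ} (P : MvPolynomial (Fin (r+1)) ℂ) (a : Fin (r+1) → ℂ) (c : Polynomial ℂ) :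
    dif P a c = ∑ l : Fin (r+1), eval a (pderiv l P) * vec r c l := by
  simp [dif, vec]

/-- product of all linear forms but one -/
def prodE {n : ℕ} (i : Fin n) (u v : Fin n → ℂ) : Polynomial ℂ :=
  ∏ k ∈ Finset.univ.erase i, lin (u k) (v k)

lemma prodL_split {n : ℕ} (lam : Fin n → ℕ) (u v : Fin n → ℂ) (i : Fin n) :
    prodL lam u v = (∏ k ∈ Finset.univ.erase i, lin (u k) (v k) ^ lam k) * lin (u i) (v i) ^ lam i := by
  rw [prodL, ← Finset.prod_erase_mul _ _ (Finset.mem_univ i)]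

lemma vec_mem_crl {r n : ℕ} {lam : Fin n → ℕ} (hl : ∑ i, lam i = r) (t : ℂ) (u v : Fin n → ℂ) :
    vec r (Polynomial.C t * prodL lam u v) ∈ crlCone r n lam := by
  rw [crl_iff hl]
  refine ⟨t, u, v, pol_vec ?_⟩
  refine (Polynomial.natDegree_C_mul_le _ _).trans ?_
  rw [← hl]
  exact natDegree_prodL_le _ _ _

lemma dif_dir {r n : ℕ} {lam : Fin n → ℕ} (hl : ∑ i, lam i = r) (h1 : ∀ i, 1 ≤ lam i)
    (P : MvPolynomial (Fin (r+1)) ℂ) (hP : ∀ y ∈ crlCone r n lam, eval y P = 0)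
    (t : ℂ) (u v : Fin n → ℂ) (i : Fin n) (a b : ℂ) (ht : t ≠ 0) :
    dif P (vec r (Polynomial.C t * prodL lam u v))
      (prodL (fun i => lam i - 1) u v * (lin a b * prodE i u v)) = 0 := by
  obtain ⟨m, hm⟩ : ∃ m, lam i = m + 1 := ⟨lam i - 1, by have := h1 i; omega⟩
  let Q : Polynomial ℂ := Polynomial.C t * ∏ k ∈ Finset.univ.erase i, lin (u k) (v k) ^ lam k
  let f : ℂ → Polynomial ℂ := fun s => lin (u i + s * a) (v i + s * b)
  have hf : PD f (lin a b) 0 := by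
    intro l
    have e : (fun s => (f s).coeff l) = fun s => (lin (u i) (v i)).coeff l + s * (lin a b).coeff l := by
      funext s
      simp only [f, lin, Polynomial.coeff_add, Polynomial.coeff_C_mul, Polynomial.coeff_C]
      split_ifs <;> ring
    rw [e]
    simpa using ((hasDerivAt_id (0:ℂ)).mul_const ((lin a b).coeff l)).const_add ((lin (u i) (v i)).coeff l)
  have hF := PD_mul_const (PD_pow hf m) Q
  have hx := eval_hasDerivAt (fun s => vec r (Q * f s ^ (m+1))) _ 0 (fun l => hF l) P
  have hz : (fun s => eval (vec r (Q * f s ^ (m+1))) P) = fun _ => 0 := by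
    funext s
    apply hP
    have := vec_mem_crl hl t (Function.update u i (u i + s * a)) (Function.update v i (v i + s * b))
    rw [prodL_split lam _ _ i, ← mul_assoc] at this
    simp only [Function.update_self] at this
    rw [hm] at this
    have e2 : ∏ k ∈ Finset.univ.erase i, lin (Function.update u i (u i + s * a) k)
        (Function.update v i (v i + s * b) k) ^ lam k = ∏ k ∈ Finset.univ.erase i, lin (u k) (v k) ^ lam k := by
      refine Finset.prod_congr rfl fun k hk => ?_
      rw [Function.update_of_ne (Finset.ne_of_mem_erase hk), Function.update_of_ne (Finset.ne_of_mem_erase hk)]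
    rw [e2] at this
    exact this
  rw [hz] at hx
  have h0 := (hasDerivAt_const (0:ℂ) (0:ℂ)).unique hx
  have e3 : f 0 = lin (u i) (v i) := by simp [f]
  have e4 : Q * f 0 ^ (m+1) = Polynomial.C t * prodL lam u v := by
    rw [e3, prodL_split lam _ _ i, hm, ← mul_assoc]
  have e5 : Q * ((m+1 : ℕ) * (f 0 ^ m * lin a b)) = (t * (m+1 : ℕ)) •
      (prodL (fun i => lam i - 1) u v * (lin a b * prodE i u v)) := by
    rw [e3, prodL_split _ _ _ i, hm, Polynomial.smul_eq_C_mul]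
    have e6 : ∏ k ∈ Finset.univ.erase i, lin (u k) (v k) ^ lam k =
       (∏ k ∈ Finset.univ.erase i, lin (u k) (v k) ^ (lam k - 1)) * prodE i u v := by
      rw [prodE, ← Finset.prod_mul_distrib]
      refine Finset.prod_congr rfl fun k _ => ?_
      rw [← pow_succ]
      congr 1
      have := h1 k; omega
    simp only [Q, e6, map_mul, Polynomial.C_eq_natCast, map_natCast, Nat.add_sub_cancel]
    ring
  rw [e4] at h0
  have h2 : dif P (vec r (Polynomial.C t * prodL lam u v)) (Q * ((m+1 : ℕ) * (f 0 ^ m * lin a b))) = 0 := by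
    rw [dif_apply]; exact h0.symm
  rw [e5, map_smul, smul_eq_mul] at h2
  refine (mul_eq_zero.1 h2).resolve_left (mul_ne_zero ht ?_)
  exact_mod_cast Nat.succ_ne_zero m

lemma span_dirs {n : ℕ} (hn : 0 < n) (u v : Fin n → ℂ) (hv : ∀ i, v i ≠ 0)
    (hd : ∀ i k, i ≠ k → u i * v k - u k * v i ≠ 0) (c : Polynomial ℂ) (hc : c.natDegree ≤ n) :
    c ∈ Submodule.span ℂ {q | ∃ i a b, q = lin a b * prodE i u v} := by
  let x : Fin n → ℂ := fun i => - u i / v i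
  have hlin : ∀ i, lin (u i) (v i) = Polynomial.C (v i) * (Polynomial.X - Polynomial.C (x i)) := by
    intro i
    simp only [lin, x]
    rw [mul_sub, ← Polynomial.C_mul, mul_div_cancel₀ _ (hv i), Polynomial.C_neg]
    ring
  have hx : Function.Injective x := by
    intro i k h
    by_contra hik
    apply hd i k hik
    simp only [x] at h
    field_simp [hv i, hv k] at h
    linear_combination -h
  have hprodE : ∀ i, (prodE i u v).eval (x i) ≠ 0 := by
    intro i
    rw [prodE, Polynomial.eval_prod, Finset.prod_ne_zero_iff]
    intro k hk
    rw [hlin]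
    simp only [Polynomial.eval_mul, Polynomial.eval_C, Polynomial.eval_sub, Polynomial.eval_X]
    exact mul_ne_zero (hv k) (sub_ne_zero.2 fun h => Finset.ne_of_mem_erase hk (hx h).symm)
  have hprodE0 : ∀ i k, i ≠ k → (prodE i u v).eval (x k) = 0 := by
    intro i k hik
    rw [prodE, Polynomial.eval_prod]
    apply Finset.prod_eq_zero (i := k) (by simp [hik.symm])
    rw [hlin]; simp
  let al : Fin n → ℂ := fun i => c.eval (x i) / (prodE i u v).eval (x i)
  let c1 : Polynomial ℂ := ∑ i, Polynomial.C (al i) * prodE i u v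
  have hc1 : ∀ k, (c - c1).eval (x k) = 0 := by
    intro k
    rw [Polynomial.eval_sub, Polynomial.eval_finset_sum, Finset.sum_eq_single k]
    · simp only [Polynomial.eval_mul, Polynomial.eval_C, al]
      rw [div_mul_cancel₀ _ (hprodE k), sub_self]
    · intro i _ hi
      rw [Polynomial.eval_mul, hprodE0 i k hi, mul_zero]
    · simp
  have hdegE : ∀ i, (prodE i u v).natDegree ≤ n := by
    intro i
    refine (Polynomial.natDegree_prod_le _ _).trans ?_
    refine (Finset.sum_le_sum fun k _ => natDegree_lin_le (u k) (v k)).trans ?_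
    simp
  have hdeg : (c - c1).natDegree ≤ n := by
    refine (Polynomial.natDegree_sub_le _ _).trans (max_le hc ?_)
    exact Polynomial.natDegree_sum_le_of_forall_le _ _ fun i _ =>
      (Polynomial.natDegree_C_mul_le _ _).trans (hdegE i)
  have hdvd : (∏ i, (Polynomial.X - Polynomial.C (x i))) ∣ c - c1 := by
    refine Finset.prod_dvd_of_coprime ?_ fun i _ => Polynomial.dvd_iff_isRoot.2 (hc1 i)
    intro i _ k _ hik
    exact Polynomial.pairwise_coprime_X_sub_C hx hik
  obtain ⟨e, he⟩ := hdvd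
  have hmon : (∏ i, (Polynomial.X - Polynomial.C (x i))).Monic := Polynomial.monic_prod_of_monic _ _ fun i _ => Polynomial.monic_X_sub_C _
  have he0 : e.natDegree = 0 := by
    by_cases h0 : e = 0
    · simp [h0]
    · rw [he, hmon.natDegree_mul' h0] at hdeg
      have : (∏ i, (Polynomial.X - Polynomial.C (x i))).natDegree = n := by
        rw [Polynomial.natDegree_prod_of_monic _ _ fun i _ => Polynomial.monic_X_sub_C _]
        simp
      omega
  obtain ⟨ε, rfl⟩ := Polynomial.natDegree_eq_zero.1 he0
  have hc2 : c = c1 + (c - c1) := by ring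
  rw [hc2]
  refine add_mem (sum_mem fun i _ => Submodule.subset_span ⟨i, al i, 0, by simp [lin]⟩) ?_
  have hP : ∏ i, lin (u i) (v i) = Polynomial.C (∏ i, v i) * ∏ i, (Polynomial.X - Polynomial.C (x i)) := by
    simp only [hlin, Finset.prod_mul_distrib, map_prod]
  have hv0 : ∏ i, v i ≠ 0 := Finset.prod_ne_zero_iff.2 fun i _ => hv i
  have e7 : c - c1 = (ε / ∏ i, v i) • ∏ i, lin (u i) (v i) := by
    rw [he, hP, Polynomial.smul_eq_C_mul, ← mul_assoc, ← Polynomial.C_mul, div_mul_cancel₀ _ hv0]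
    ring
  rw [e7]
  refine Submodule.smul_mem _ _ (Submodule.subset_span ⟨⟨0, hn⟩, u ⟨0, hn⟩, v ⟨0, hn⟩, ?_⟩)
  exact (Finset.mul_prod_erase Finset.univ (fun k => lin (u k) (v k)) (Finset.mem_univ _)).symm

lemma natDegree_G {r n : ℕ} {lam : Fin n → ℕ} (hl : ∑ i, lam i = r) (h1 : ∀ i, 1 ≤ lam i) (u v : Fin n → ℂ) :
    (prodL (fun i => lam i - 1) u v).natDegree + n ≤ r := by
  have h := natDegree_prodL_le (fun i => lam i - 1) u v
  have : ∑ i, (lam i - 1) + n = r := by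
    rw [← hl]
    have : ∑ i, lam i = ∑ i, ((lam i - 1) + 1) := Finset.sum_congr rfl fun i _ => by have := h1 i; omega
    rw [this, Finset.sum_add_distrib]
    simp
  omega

/-- tangent lower bound -/
lemma dif_vanish {r n : ℕ} {lam : Fin n → ℕ} (hn : 0 < n) (hl : ∑ i, lam i = r) (h1 : ∀ i, 1 ≤ lam i)
    (P : MvPolynomial (Fin (r+1)) ℂ) (hP : ∀ y ∈ crlCone r n lam, eval y P = 0)
    (t : ℂ) (u v : Fin n → ℂ) (c : Polynomial ℂ) (hc : c.natDegree ≤ n) :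
    dif P (vec r (Polynomial.C t * prodL lam u v)) (prodL (fun i => lam i - 1) u v * c) = 0 := by
  have gen : ∀ (t : ℂ) (u v : Fin n → ℂ), t ≠ 0 → (∀ i, v i ≠ 0) →
      (∀ i k, i ≠ k → u i * v k - u k * v i ≠ 0) →
      dif P (vec r (Polynomial.C t * prodL lam u v)) (prodL (fun i => lam i - 1) u v * c) = 0 := by
    intro t u v ht hv hd
    have := span_dirs hn u v hv hd c hc
    clear hc
    induction this using Submodule.span_induction with
    | mem q hq => obtain ⟨i, a, b, rfl⟩ := hq; exact dif_dir hl h1 P hP t u v i a b ht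
    | zero => simp
    | add x y _ _ hx hy => rw [mul_add, map_add, hx, hy, add_zero]
    | smul a x _ hx => rw [mul_smul_comm, map_smul, hx, smul_zero]
  let U : ℂ → Fin n → ℂ := fun s i => (1 - s) * u i + s * (i : ℕ)
  let V : ℂ → Fin n → ℂ := fun s i => (1 - s) * v i + s * 1
  let τ : ℂ → ℂ := fun s => (1 - s) * t + s * 1
  have hU : ∀ i, (fun s => U s i) ∈ P1 := fun i => P1_line _ _
  have hV : ∀ i, (fun s => V s i) ∈ P1 := fun i => P1_line _ _
  have hτ : τ ∈ P1 := P1_line _ _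
  let f : ℂ → ℂ := fun s => dif P (vec r (Polynomial.C (τ s) * prodL lam (U s) (V s)))
    (prodL (fun i => lam i - 1) (U s) (V s) * c)
  have hf : f ∈ P1 := by
    simp only [f, dif_apply]
    refine P1_sum _ fun l _ => P1_mul ?_ ?_
    · exact P1_eval (fun s => vec r (Polynomial.C (τ s) * prodL lam (U s) (V s))) (fun i => PC_mul (PC_C hτ) (PC_prodL lam hU hV) i) _
    · exact PC_mul (PC_prodL _ hU hV) (PC_const c) l
  let g : ℂ → ℂ := fun s => τ s * ((∏ i, V s i) * ∏ i, ∏ k, if i ≠ k then U s i * V s k - U s k * V s i else 1)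
  have hg : g ∈ P1 := by
    refine P1_mul hτ (P1_mul (P1_prod _ fun i _ => hV i) (P1_prod _ fun i _ => P1_prod _ fun k _ => ?_))
    split_ifs
    · exact P1_sub (P1_mul (hU _) (hV _)) (P1_mul (hU _) (hV _))
    · exact P1_const 1
  have := P1_dense hf hg 1 ?_ ?_ 0
  · simpa [f, U, V, τ] using this
  · simp only [g]
    refine mul_ne_zero (by simp [τ]) (mul_ne_zero (by simp [V]) ?_)
    refine Finset.prod_ne_zero_iff.2 fun i _ => Finset.prod_ne_zero_iff.2 fun k _ => ?_
    split_ifs with h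
    · simp only [U, V]
      simp only [sub_self, zero_mul, zero_add, one_mul, mul_one]
      rw [sub_ne_zero]
      intro h'
      exact h (Fin.ext (by exact_mod_cast h'))
    · exact one_ne_zero
  · intro s hs
    simp only [g] at hs
    refine gen _ _ _ (left_ne_zero_of_mul hs) ?_ ?_
    · intro i
      exact Finset.prod_ne_zero_iff.1 (left_ne_zero_of_mul (right_ne_zero_of_mul hs)) i (Finset.mem_univ _)
    · intro i k hik
      have := Finset.prod_ne_zero_iff.1 (Finset.prod_ne_zero_iff.1 (right_ne_zero_of_mul (right_ne_zero_of_mul hs)) i (Finset.mem_univ _)) k (Finset.mem_univ _)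
      rwa [if_pos hik] at this

/-- the tangent space as a submodule -/
def zTanSub {σ : Type} [Fintype σ] [DecidableEq σ] (S : Set (σ → ℂ)) (a : σ → ℂ) : Submodule ℂ (σ → ℂ) where
  carrier := zTangentAt S a
  add_mem' {x y} hx hy p hp := by
    have h1 := hx p hp
    have h2 := hy p hp
    simp only [Pi.add_apply, mul_add, Finset.sum_add_distrib, h1, h2, add_zero]
  zero_mem' p hp := by simp
  smul_mem' c x hx p hp := by
    have h1 := hx p hp
    simp only [Pi.smul_apply, smul_eq_mul, mul_left_comm _ c, ← Finset.mul_sum, h1, mul_zero]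

lemma span_zTangentAt {σ : Type} [Fintype σ] [DecidableEq σ] (S : Set (σ → ℂ)) (a : σ → ℂ) :
    Submodule.span ℂ (zTangentAt S a) = zTanSub S a :=
  Submodule.span_eq (zTanSub S a)

/-- multiplication by a polynomial in coordinates -/
def mulMap (r N : ℕ) (G : Polynomial ℂ) : (Fin (N+1) → ℂ) →ₗ[ℂ] (Fin (r+1) → ℂ) :=
  vecL r ∘ₗ LinearMap.mulLeft ℂ G ∘ₗ polL N

lemma mulMap_apply (r N : ℕ) (G : Polynomial ℂ) (c : Fin (N+1) → ℂ) : mulMap r N G c = vec r (G * pol c) := rfl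

lemma natDegree_mul_le_of {G c : Polynomial ℂ} {N r : ℕ} (h : G.natDegree + N ≤ r) (hc : c.natDegree ≤ N) :
    (G * c).natDegree ≤ r := by
  refine Polynomial.natDegree_mul_le.trans (by omega)

lemma pol_mulMap {r N : ℕ} {G : Polynomial ℂ} (h : G.natDegree + N ≤ r) (c : Fin (N+1) → ℂ) :
    pol (mulMap r N G c) = G * pol c := by
  rw [mulMap_apply, pol_vec (natDegree_mul_le_of h (natDegree_pol_le c))]

lemma mulMap_inj {r N : ℕ} {G : Polynomial ℂ} (h : G.natDegree + N ≤ r) (hG : G ≠ 0) :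
    Function.Injective (mulMap r N G) := by
  intro c c' hcc
  have := congrArg pol hcc
  rw [pol_mulMap h, pol_mulMap h] at this
  exact pol_injective (mul_left_cancel₀ hG this)

lemma finrank_mulMap {r N : ℕ} {G : Polynomial ℂ} (h : G.natDegree + N ≤ r) (hG : G ≠ 0) :
    Module.finrank ℂ (LinearMap.range (mulMap r N G)) = N + 1 := by
  rw [LinearMap.finrank_range_of_inj (mulMap_inj h hG)]
  simp

lemma mem_range_mulMap {r N : ℕ} {G : Polynomial ℂ} (h : G.natDegree + N ≤ r) (w : Fin (r+1) → ℂ) :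
    w ∈ LinearMap.range (mulMap r N G) ↔ ∃ c : Polynomial ℂ, c.natDegree ≤ N ∧ pol w = G * c := by
  constructor
  · rintro ⟨c, rfl⟩
    exact ⟨pol c, natDegree_pol_le c, pol_mulMap h c⟩
  · rintro ⟨c, hc, hw⟩
    refine ⟨vec N c, ?_⟩
    rw [mulMap_apply, pol_vec hc, ← hw, vec_pol]

lemma range_le_tan {r n : ℕ} {lam : Fin n → ℕ} (hn : 0 < n) (hl : ∑ i, lam i = r) (h1 : ∀ i, 1 ≤ lam i)
    (a : Fin (r+1) → ℂ) (t : ℂ) (u v : Fin n → ℂ) (ha : pol a = Polynomial.C t * prodL lam u v) :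
    LinearMap.range (mulMap r n (prodL (fun i => lam i - 1) u v)) ≤ zTanSub (crlCone r n lam) a := by
  rintro _ ⟨c, rfl⟩
  intro P hP
  have := dif_vanish hn hl h1 P hP t u v (pol c) (natDegree_pol_le c)
  rw [← ha, vec_pol, dif_apply] at this
  exact this

lemma nz_of_pol {r n : ℕ} {lam : Fin n → ℕ} (h1 : ∀ i, 1 ≤ lam i)
    (a : Fin (r+1) → ℂ) (t : ℂ) (u v : Fin n → ℂ) (ha : pol a = Polynomial.C t * prodL lam u v) (h0 : a ≠ 0) :
    t ≠ 0 ∧ ∀ i, u i ≠ 0 ∨ v i ≠ 0 := by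
  have hp : pol a ≠ 0 := by
    intro h
    apply h0
    rw [← vec_pol a, h]; rfl
  rw [ha] at hp
  refine ⟨?_, ?_⟩
  · rintro rfl
    simp at hp
  · intro i
    by_contra hcon
    push Not at hcon
    have h2 := Finset.prod_ne_zero_iff.1 (right_ne_zero_of_mul hp) i (Finset.mem_univ _)
    apply h2
    have := h1 i
    simp [hcon.1, hcon.2, lin]
    omega

lemma tan_eq {r n : ℕ} {lam : Fin n → ℕ} (hn : 0 < n) (hl : ∑ i, lam i = r) (h1 : ∀ i, 1 ≤ lam i)
    (a : Fin (r+1) → ℂ) (t : ℂ) (u v : Fin n → ℂ) (ha : pol a = Polynomial.C t * prodL lam u v) (h0 : a ≠ 0)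
    (hd : zTangentDim (crlCone r n lam) a ≤ n + 1) :
    zTanSub (crlCone r n lam) a = LinearMap.range (mulMap r n (prodL (fun i => lam i - 1) u v)) := by
  symm
  apply Submodule.eq_of_le_of_finrank_le (range_le_tan hn hl h1 a t u v ha)
  rw [finrank_mulMap (natDegree_G hl h1 u v) (prodL_ne_zero _ (nz_of_pol h1 a t u v ha h0).2)]
  rwa [zTangentDim, span_zTangentAt] at hd

lemma tan_dim_of_le {r n : ℕ} {lam : Fin n → ℕ} (hn : 0 < n) (hl : ∑ i, lam i = r) (h1 : ∀ i, 1 ≤ lam i)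
    (a : Fin (r+1) → ℂ) (t : ℂ) (u v : Fin n → ℂ) (ha : pol a = Polynomial.C t * prodL lam u v) (h0 : a ≠ 0)
    (hd : zTangentDim (crlCone r n lam) a ≤ n + 1) :
    zTangentDim (crlCone r n lam) a = n + 1 := by
  rw [zTangentDim, span_zTangentAt, tan_eq hn hl h1 a t u v ha h0 hd,
    finrank_mulMap (natDegree_G hl h1 u v) (prodL_ne_zero _ (nz_of_pol h1 a t u v ha h0).2)]

lemma jac_one {τ σ : Type} [Fintype σ] [DecidableEq σ] (φ : σ → MvPolynomial τ ℂ) (J : Set σ)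
    (hJ : AlgebraicIndepOn ℂ φ J) (k : σ) (hk : k ∉ J) (hnot : ¬ AlgebraicIndepOn ℂ φ (insert k J)) :
    ∃ P : MvPolynomial σ ℂ, aeval φ P = 0 ∧ aeval φ (pderiv k P) ≠ 0 ∧ ∀ l ∉ J, l ≠ k → pderiv l P = 0 := by
  have hJ' : AlgebraicIndependent ℂ (fun i : J => φ i) := hJ
  have hinj := algebraicIndependent_iff_injective_aeval.1 hJ'
  let ψ : MvPolynomial J ℂ →+* MvPolynomial τ ℂ := (aeval (fun i : J => φ i)).toRingHom
  have hψ : ∀ c, ψ c = 0 → c = 0 := fun c hc => hinj (by rw [map_zero]; exact hc)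
  have hex : ∃ p : Polynomial (MvPolynomial J ℂ), p ≠ 0 ∧ Polynomial.eval₂ ψ (φ k) p = 0 := by
    have h2 : ¬ Transcendental (Algebra.adjoin ℂ (φ '' J)) (φ k) := fun h => hnot (hJ.insert h)
    rw [Set.image_eq_range, Transcendental, not_not] at h2
    obtain ⟨q, hq0, hq⟩ := h2
    refine ⟨q.map hJ'.aevalEquiv.symm.toRingEquiv.toRingHom, ?_, ?_⟩
    · rw [Ne, Polynomial.map_eq_zero_iff]
      · exact hq0
      · exact hJ'.aevalEquiv.symm.injective
    · rw [Polynomial.eval₂_map]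
      have e : ψ.comp hJ'.aevalEquiv.symm.toRingEquiv.toRingHom = algebraMap _ _ := by
        ext1 x
        exact hJ'.aeval_repr x
      rw [e]
      exact hq
  classical
  obtain ⟨p, ⟨hp0, hp⟩, hmin⟩ := WellFounded.has_min (measure (fun p : Polynomial (MvPolynomial J ℂ) => p.natDegree)).wf
    {p | p ≠ 0 ∧ Polynomial.eval₂ ψ (φ k) p = 0} hex
  have hdeg : p.natDegree ≠ 0 := by
    intro h
    obtain ⟨c, rfl⟩ := Polynomial.natDegree_eq_zero.1 h
    rw [Polynomial.eval₂_C] at hp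
    exact hp0 (by rw [hψ c hp, map_zero])
  have hder : Polynomial.eval₂ ψ (φ k) (Polynomial.derivative p) ≠ 0 := by
    intro h
    refine hmin (Polynomial.derivative p) ⟨?_, h⟩ (Polynomial.natDegree_derivative_lt hdeg)
    intro h0
    exact hdeg (Polynomial.natDegree_eq_zero_of_derivative_eq_zero h0)
  let ρ : MvPolynomial J ℂ →+* MvPolynomial σ ℂ := (rename (Subtype.val : J → σ)).toRingHom
  have hρ : ∀ l ∉ J, ∀ c, pderiv l (ρ c) = 0 := by
    intro l hl c
    apply pderiv_eq_zero_of_notMem_vars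
    intro h
    have := vars_rename (Subtype.val : J → σ) c h
    obtain ⟨x, _, hx⟩ := Finset.mem_image.1 this
    exact hl (hx ▸ x.2)
  have hco : ∀ q, aeval φ (Polynomial.eval₂ ρ (X k) q) = Polynomial.eval₂ ψ (φ k) q := by
    intro q
    have := Polynomial.hom_eval₂ q ρ (aeval φ : MvPolynomial σ ℂ →ₐ[ℂ] MvPolynomial τ ℂ).toRingHom (X k)
    have e : (aeval φ : MvPolynomial σ ℂ →ₐ[ℂ] MvPolynomial τ ℂ).toRingHom.comp ρ = ψ := by
      apply MvPolynomial.ringHom_ext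
      · intro c; simp [ρ, ψ]
      · intro c; simp [ρ, ψ]
    rw [e] at this
    simpa using this
  have hpk : ∀ q, pderiv k (Polynomial.eval₂ ρ (X k) q) = Polynomial.eval₂ ρ (X k) (Polynomial.derivative q) := by
    intro q
    induction q using Polynomial.induction_on' with
    | add a b ha hb => simp [Polynomial.eval₂_add, ha, hb]
    | monomial m c =>
      rw [Polynomial.eval₂_monomial, Polynomial.derivative_monomial, Polynomial.eval₂_monomial,
        Derivation.leibniz, hρ k hk, Derivation.leibniz_pow]
      simp
      ring
  refine ⟨Polynomial.eval₂ ρ (X k) p, by rw [hco, hp], by rwa [hpk, hco], ?_⟩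
  intro l hl hlk
  clear hmin hder hdeg hp hp0
  induction p using Polynomial.induction_on' with
    | add a b ha hb => simp [Polynomial.eval₂_add, ha, hb]
    | monomial m c =>
      rw [Polynomial.eval₂_monomial, Derivation.leibniz, hρ l hl, Derivation.leibniz_pow, pderiv_X_of_ne (Ne.symm hlk)]
      simp

lemma jac {τ σ : Type} [Fintype σ] [DecidableEq σ] [Fintype τ] (φ : σ → MvPolynomial τ ℂ) :
    ∃ (J : Finset σ) (P : σ → MvPolynomial σ ℂ), J.card ≤ Fintype.card τ ∧
      ∀ k ∉ J, aeval φ (P k) = 0 ∧ aeval φ (pderiv k (P k)) ≠ 0 ∧ ∀ l ∉ J, l ≠ k → pderiv l (P k) = 0 := by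
  classical
  obtain ⟨J, hJ, hmax⟩ := Finset.exists_max_image
    (Finset.univ.filter fun J : Finset σ => AlgebraicIndepOn ℂ φ (J : Set σ)) Finset.card
    ⟨∅, by
      simp only [Finset.mem_filter, Finset.mem_univ, true_and, Finset.coe_empty]
      rw [AlgebraicIndepOn, algebraicIndependent_empty_type_iff]
      exact (algebraMap ℂ (MvPolynomial τ ℂ)).injective⟩
  simp only [Finset.mem_filter, Finset.mem_univ, true_and] at hJ hmax
  have hP : ∀ k, ∃ P : MvPolynomial σ ℂ, k ∉ J → aeval φ P = 0 ∧ aeval φ (pderiv k P) ≠ 0 ∧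
      ∀ l ∉ J, l ≠ k → pderiv l P = 0 := by
    intro k
    by_cases hk : k ∈ J
    · exact ⟨0, fun h => absurd hk h⟩
    · obtain ⟨P, hP⟩ := jac_one φ J hJ k (by simpa using hk) (by
        intro h
        have := hmax (insert k J) (by simpa using h)
        rw [Finset.card_insert_of_notMem hk] at this
        omega)
      exact ⟨P, fun _ => hP⟩
  choose P hP using hP
  refine ⟨J, P, ?_, fun k hk => hP k hk⟩
  have h1 := AlgebraicIndependent.cardinalMk_le_trdeg (show AlgebraicIndependent ℂ (fun i : (J : Set σ) => φ i) from hJ)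
  rw [MvPolynomial.trdeg_of_isDomain] at h1
  simpa using h1

def zz {n : ℕ} (lam : Fin n → ℕ) (u v : Fin n → ℂ) : Option (Fin n) → ℂ :=
  fun o => o.elim (∏ i, v i ^ lam i) (fun i => u i / v i)

lemma clear_den {n : ℕ} (lam : Fin n → ℕ) (D0 : MvPolynomial (Option (Fin n)) ℂ) :
    ∃ (N : ℕ) (D : MvPolynomial (Fin n ⊕ Fin n) ℂ), ∀ u v : Fin n → ℂ, (∀ i, v i ≠ 0) →
      eval (Sum.elim u v) D = (∏ i, v i) ^ N * eval (zz lam u v) D0 := by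
  induction D0 using MvPolynomial.induction_on with
  | C a => exact ⟨0, C a, fun u v _ => by simp⟩
  | add p q hp hq =>
    obtain ⟨N, D, h⟩ := hp
    obtain ⟨M, E, h'⟩ := hq
    refine ⟨N + M, (∏ i, X (Sum.inr i)) ^ M * D + (∏ i, X (Sum.inr i)) ^ N * E, fun u v hv => ?_⟩
    simp only [map_add, map_mul, map_pow, map_prod, eval_X, Sum.elim_inr, h u v hv, h' u v hv]
    ring
  | mul_X p o hp =>
    obtain ⟨N, D, h⟩ := hp
    cases o with
    | none =>
      refine ⟨N, D * ∏ i, X (Sum.inr i) ^ lam i, fun u v hv => ?_⟩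
      simp only [map_mul, map_pow, map_prod, eval_X, Sum.elim_inr, h u v hv, zz, Option.elim]
      ring
    | some i =>
      refine ⟨N + 1, D * (X (Sum.inl i) * ∏ k ∈ Finset.univ.erase i, X (Sum.inr k)), fun u v hv => ?_⟩
      simp only [map_mul, map_prod, eval_X, Sum.elim_inr, Sum.elim_inl, h u v hv]
      rw [pow_succ, ← Finset.mul_prod_erase Finset.univ v (Finset.mem_univ i)]
      have := hv i
      simp only [zz, Option.elim]
      field_simp

lemma prodL_scale {n : ℕ} (lam : Fin n → ℕ) (u v : Fin n → ℂ) (hv : ∀ i, v i ≠ 0) :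
    prodL lam u v = Polynomial.C (∏ i, v i ^ lam i) * prodL lam (fun i => u i / v i) 1 := by
  rw [prodL, prodL, map_prod, ← Finset.prod_mul_distrib]
  refine Finset.prod_congr rfl fun i _ => ?_
  rw [Polynomial.C_pow, ← mul_pow]
  congr 1
  simp only [lin, Pi.one_apply]
  rw [mul_add, ← Polynomial.C_mul, mul_div_cancel₀ _ (hv i)]
  simp

def genPoly {n : ℕ} (lam : Fin n → ℕ) : Polynomial (MvPolynomial (Option (Fin n)) ℂ) :=
  Polynomial.C (X none) * ∏ i, (Polynomial.C (X (some i)) + Polynomial.X) ^ lam i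

lemma eval_genPoly {n : ℕ} (lam : Fin n → ℕ) (z : Option (Fin n) → ℂ) (l : ℕ) :
    eval z ((genPoly lam).coeff l) = (Polynomial.C (z none) * prodL lam (fun i => z (some i)) 1).coeff l := by
  rw [← Polynomial.coeff_map]
  congr 1
  simp [genPoly, prodL, lin, Polynomial.map_prod]

lemma generic_smooth {r n : ℕ} {lam : Fin n → ℕ} (hn : 0 < n) (hl : ∑ i, lam i = r) (h1 : ∀ i, 1 ≤ lam i) :
    ∃ D : MvPolynomial (Fin n ⊕ Fin n) ℂ, (∃ u v, (∀ i, v i ≠ 0) ∧ eval (Sum.elim u v) D ≠ 0) ∧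
      ∀ u v : Fin n → ℂ, (∀ i, v i ≠ 0) → eval (Sum.elim u v) D ≠ 0 →
        zTangentDim (crlCone r n lam) (vec r (prodL lam u v)) = n + 1 := by
  obtain ⟨J, P, hJ, hP⟩ := jac (fun l : Fin (r+1) => (genPoly lam).coeff l)
  have hev : ∀ (z : Option (Fin n) → ℂ) (Q : MvPolynomial (Fin (r+1)) ℂ),
      eval z (aeval (fun l : Fin (r+1) => (genPoly lam).coeff l) Q) =
        eval (vec r (Polynomial.C (z none) * prodL lam (fun i => z (some i)) 1)) Q := by
    intro z Q
    induction Q using MvPolynomial.induction_on with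
    | C c => simp [algebraMap_eq]
    | add p q hp hq => rw [map_add, map_add, hp, hq, map_add]
    | mul_X p l hp => rw [map_mul, map_mul, hp, aeval_X, eval_genPoly, map_mul, eval_X]; rfl
  have hpar : ∀ (u v : Fin n → ℂ), (∀ i, v i ≠ 0) → ∀ Q : MvPolynomial (Fin (r+1)) ℂ,
      eval (zz lam u v) (aeval (fun l : Fin (r+1) => (genPoly lam).coeff l) Q) =
        eval (vec r (prodL lam u v)) Q := by
    intro u v hv Q
    rw [hev, prodL_scale lam u v hv]
    rfl
  -- the relations vanish on the whole cone
  have hPv : ∀ k ∉ J, ∀ y ∈ crlCone r n lam, eval y (P k) = 0 := by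
    intro k hk y hy
    obtain ⟨t, u, v, hy⟩ := (crl_iff hl y).1 hy
    have gen : ∀ (t : ℂ) (u v : Fin n → ℂ), (∀ i, v i ≠ 0) →
        eval (vec r (Polynomial.C t * prodL lam u v)) (P k) = 0 := by
      intro t u v hv
      have := hev (fun o => o.elim (t * ∏ i, v i ^ lam i) fun i => u i / v i) (P k)
      rw [(hP k hk).1, map_zero] at this
      rw [prodL_scale lam u v hv, ← mul_assoc, ← Polynomial.C_mul]
      exact this.symm
    let V : ℂ → Fin n → ℂ := fun s i => (1 - s) * v i + s * 1
    have hV : ∀ i, (fun s => V s i) ∈ P1 := fun i => P1_line _ _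
    have hf : (fun s => eval (vec r (Polynomial.C t * prodL lam u (V s))) (P k)) ∈ P1 :=
      P1_eval (fun s => vec r (Polynomial.C t * prodL lam u (V s)))
        (fun i => PC_mul (PC_const _) (PC_prodL lam (u := fun _ => u) (fun i => P1_const _) hV) i) _
    have hg : (fun s => ∏ i, V s i) ∈ P1 := P1_prod _ fun i _ => hV i
    have := P1_dense hf hg 1 (by simp [V])
      (fun s hs => gen _ _ _ fun i => Finset.prod_ne_zero_iff.1 hs i (Finset.mem_univ _)) 0
    simp only [V, sub_zero, one_mul, zero_mul, add_zero] at this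
    rwa [← hy, vec_pol] at this
  let D0 : MvPolynomial (Option (Fin n)) ℂ :=
    X none * ∏ k ∈ Finset.univ \ J, aeval (fun l : Fin (r+1) => (genPoly lam).coeff l) (pderiv k (P k))
  have hD0 : D0 ≠ 0 := by
    refine mul_ne_zero (X_ne_zero _) (Finset.prod_ne_zero_iff.2 fun k hk => ?_)
    exact (hP k (by simpa using hk)).2.1
  obtain ⟨N, D, hD⟩ := clear_den lam D0
  refine ⟨D, ?_, ?_⟩
  · obtain ⟨z, hz⟩ : ∃ z, eval z D0 ≠ 0 := by
      by_contra hcon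
      push Not at hcon
      exact hD0 (MvPolynomial.funext fun z => by rw [hcon z, map_zero])
    have hz0 : z none ≠ 0 := by
      intro h
      apply hz
      simp [D0, h]
    let i0 : Fin n := ⟨0, hn⟩
    obtain ⟨y, hy⟩ := IsAlgClosed.exists_pow_nat_eq (z none) (h1 i0)
    have hy0 : y ≠ 0 := by
      rintro rfl
      rw [zero_pow (by have := h1 i0; omega)] at hy
      exact hz0 hy.symm
    let v : Fin n → ℂ := Function.update 1 i0 y
    have hv : ∀ i, v i ≠ 0 := by
      intro i
      by_cases h : i = i0
      · subst h; simpa [v] using hy0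
      · simp [v, Function.update_of_ne h]
    refine ⟨fun i => z (some i) * v i, v, hv, ?_⟩
    rw [hD _ _ hv]
    refine mul_ne_zero (pow_ne_zero _ (Finset.prod_ne_zero_iff.2 fun i _ => hv i)) ?_
    have : zz lam (fun i => z (some i) * v i) v = z := by
      funext o
      cases o with
      | none =>
        simp only [zz, Option.elim]
        rw [Finset.prod_eq_single i0]
        · simpa [v] using hy
        · intro b _ hb; simp [v, Function.update_of_ne hb]
        · simp
      | some i =>
        simp only [zz, Option.elim]
        rw [mul_div_cancel_right₀ _ (hv i)]
    rwa [this]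
  · intro u v hv hne
    rw [hD _ _ hv] at hne
    have hne := right_ne_zero_of_mul hne
    simp only [D0, map_mul, map_prod, hpar u v hv] at hne
    have hne := Finset.prod_ne_zero_iff.1 (right_ne_zero_of_mul hne)
    have hdeg : (prodL lam u v).natDegree ≤ r := by rw [← hl]; exact natDegree_prodL_le _ _ _
    apply tan_dim_of_le hn hl h1 _ 1 u v
    · rw [pol_vec hdeg]; simp
    · intro h
      have := pol_vec hdeg
      rw [h] at this
      exact prodL_ne_zero lam (fun i => Or.inr (hv i)) (by rw [← this]; simp [pol])
    rw [zTangentDim, span_zTangentAt]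
    let R : zTanSub (crlCone r n lam) (vec r (prodL lam u v)) →ₗ[ℂ] (J → ℂ) :=
      (LinearMap.funLeft ℂ ℂ (Subtype.val : J → Fin (r+1))) ∘ₗ Submodule.subtype _
    have hR : Function.Injective R := by
      rw [← LinearMap.ker_eq_bot, LinearMap.ker_eq_bot']
      rintro ⟨w, hw⟩ h0
      have hwJ : ∀ l ∈ J, w l = 0 := fun l hl => congrFun h0 ⟨l, hl⟩
      ext k
      show w k = 0
      by_cases hk : k ∈ J
      · exact hwJ k hk
      · have := hw (P k) (hPv k hk)
        rw [Finset.sum_eq_single k] at this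
        · exact (mul_eq_zero.1 this).resolve_left (hne k (by simp [hk]))
        · intro l _ hlk
          by_cases hlJ : l ∈ J
          · rw [hwJ l hlJ, mul_zero]
          · rw [(hP k hk).2.2 l hlJ hlk, map_zero, zero_mul]
        · simp
    have := LinearMap.finrank_le_finrank_of_injective hR
    simp at this hJ
    omega

lemma P1_both {f g : ℂ → ℂ} (hf : f ∈ P1) (hg : g ∈ P1) {s0 s1 : ℂ} (h0 : f s0 ≠ 0) (h1 : g s1 ≠ 0) :
    ∃ s, f s ≠ 0 ∧ g s ≠ 0 := by
  by_contra hcon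
  push Not at hcon
  exact h0 (P1_dense hf hg s1 h1 (fun s hs => by_contra fun h => hs (hcon s h)) s0)

lemma left_inv_matrix {a b : Type} [Fintype a] [Fintype b] [DecidableEq a] [DecidableEq b]
    (N : Matrix a b ℂ) (h : ∀ x, N.mulVec x = 0 → x = 0) : ∃ C : Matrix b a ℂ, C * N = 1 := by
  obtain ⟨g, hg⟩ := LinearMap.exists_leftInverse_of_injective (Matrix.toLin' N)
    (LinearMap.ker_eq_bot'.2 (fun x hx => h x (by simpa using hx)))
  refine ⟨LinearMap.toMatrix' g, ?_⟩
  have := congrArg LinearMap.toMatrix' hg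
  rwa [LinearMap.toMatrix'_comp, LinearMap.toMatrix'_toLin', LinearMap.toMatrix'_id] at this

/-- nondegeneracy: no nonzero operator of degree `≤ M` kills `h` -/
def ND (d M : ℕ) (h : Fin (d+1) → ℂ) : Prop :=
  ∀ p : Polynomial ℂ, p ≠ 0 → p.natDegree ≤ M → ∃ s : Polynomial ℂ, s.natDegree ≤ d - M ∧ Lf d h (p * s) ≠ 0

def wt (d l : ℕ) : ℂ := ((d - l : ℕ).factorial * (l : ℕ).factorial : ℕ)

lemma wt_ne_zero (d l : ℕ) : wt d l ≠ 0 := by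
  unfold wt
  exact_mod_cast Nat.mul_ne_zero (Nat.factorial_ne_zero _) (Nat.factorial_ne_zero _)

lemma Lf_eq (d : ℕ) (h : Fin (d+1) → ℂ) (p : Polynomial ℂ) :
    Lf d h p = ∑ l : Fin (d+1), wt d l * p.coeff l * h l := by
  rw [Lf_apply]
  exact Finset.sum_congr rfl fun l _ => by unfold wt; ring

lemma Lf_smul (d : ℕ) (c : ℂ) (h : Fin (d+1) → ℂ) (p : Polynomial ℂ) : Lf d (c • h) p = c * Lf d h p := by
  rw [Lf_eq, Lf_eq, Finset.mul_sum]
  exact Finset.sum_congr rfl fun l _ => by simp only [Pi.smul_apply, smul_eq_mul]; ring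

/-- realise a functional -/
lemma exists_Lf (d : ℕ) (L : Polynomial ℂ →ₗ[ℂ] ℂ) :
    ∃ h : Fin (d+1) → ℂ, ∀ p : Polynomial ℂ, p.natDegree ≤ d → Lf d h p = L p := by
  refine ⟨fun l => L (Polynomial.X ^ (l : ℕ)) / wt d l, fun p hp => ?_⟩
  rw [Lf_eq]
  conv_rhs => rw [← pol_vec hp, pol, map_sum]
  refine Finset.sum_congr rfl fun l _ => ?_
  rw [← Polynomial.smul_eq_C_mul, map_smul, smul_eq_mul, vec]
  have := wt_ne_zero d l
  field_simp

lemma special {d e n M : ℕ} (hd : d = e + n) (hM : M < e) (hMn : M ≤ n) (q : Polynomial ℂ) (hq : q.natDegree = e) :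
    ∃ h : Fin (d+1) → ℂ, (∀ c : Polynomial ℂ, c.natDegree ≤ n → Lf d h (q * c) = 0) ∧ ND d M h := by
  have hq0 : q ≠ 0 := by rintro rfl; simp at hq; omega
  let qm := q * Polynomial.C q.leadingCoeff⁻¹
  have hmon : qm.Monic := Polynomial.monic_mul_leadingCoeff_inv hq0
  have hlc : q.leadingCoeff ≠ 0 := Polynomial.leadingCoeff_ne_zero.2 hq0
  have hqm : qm.natDegree = e := by
    rw [Polynomial.natDegree_mul_C (inv_ne_zero hlc), hq]
  obtain ⟨h, hh⟩ := exists_Lf d ((Polynomial.lcoeff ℂ (e-1)) ∘ₗ Polynomial.modByMonicHom qm)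
  refine ⟨h, ?_, ?_⟩
  · intro c hc
    rw [hh _ (natDegree_mul_le_of (by omega) hc)]
    have : (q * c) %ₘ qm = 0 := by
      rw [Polynomial.modByMonic_eq_zero_iff_dvd hmon]
      refine Dvd.dvd.mul_right ⟨Polynomial.C q.leadingCoeff, ?_⟩ c
      rw [mul_assoc, ← Polynomial.C_mul, inv_mul_cancel₀ hlc]; simp
    simp [Polynomial.modByMonicHom, this]
  · intro p hp0 hp
    refine ⟨Polynomial.X ^ (e - 1 - p.natDegree), by simp; omega, ?_⟩
    have hdeg : (p * Polynomial.X ^ (e - 1 - p.natDegree)).natDegree = e - 1 := by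
      rw [Polynomial.natDegree_mul_X_pow _ hp0]; omega
    rw [hh _ (by omega)]
    have h2 : (p * Polynomial.X ^ (e - 1 - p.natDegree)) %ₘ qm = p * Polynomial.X ^ (e - 1 - p.natDegree) := by
      rw [Polynomial.modByMonic_eq_self_iff hmon]
      apply Polynomial.degree_lt_degree
      omega
    simp only [LinearMap.comp_apply, Polynomial.modByMonicHom, LinearMap.coe_mk, AddHom.coe_mk, h2, Polynomial.lcoeff_apply]
    have h3 : (p * Polynomial.X ^ (e - 1 - p.natDegree)).coeff (e - 1) =
        (p * Polynomial.X ^ (e - 1 - p.natDegree)).leadingCoeff := by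
      rw [Polynomial.leadingCoeff, hdeg]
    rw [h3]
    simpa using hp0

lemma natDegree_prodL_eq {n : ℕ} (lam : Fin n → ℕ) (u v : Fin n → ℂ) (hv : ∀ i, v i ≠ 0) :
    (prodL lam u v).natDegree = ∑ i, lam i := by
  rw [prodL, Polynomial.natDegree_prod _ _ fun i _ => pow_ne_zero _ (lin_ne_zero (Or.inr (hv i)))]
  refine Finset.sum_congr rfl fun i _ => ?_
  rw [Polynomial.natDegree_pow]
  have : (lin (u i) (v i)).natDegree = 1 := by
    apply le_antisymm (natDegree_lin_le _ _)
    apply Polynomial.le_natDegree_of_ne_zero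
    simp [lin, hv i]
  rw [this, mul_one]

/-- matrix of the operator `q` acting -/
def Aop (d n : ℕ) (q : Polynomial ℂ) : Matrix (Fin (n+1)) (Fin (d+1)) ℂ :=
  fun m l => wt d l * (q * Polynomial.X ^ (m : ℕ)).coeff l

lemma Aop_mulVec (d n : ℕ) (q : Polynomial ℂ) (h : Fin (d+1) → ℂ) (m : Fin (n+1)) :
    (Aop d n q).mulVec h m = Lf d h (q * Polynomial.X ^ (m : ℕ)) := by
  rw [Lf_eq]; rfl

lemma Aop_zero_iff (d n : ℕ) (q : Polynomial ℂ) (h : Fin (d+1) → ℂ) :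
    (Aop d n q).mulVec h = 0 ↔ ∀ c : Polynomial ℂ, c.natDegree ≤ n → Lf d h (q * c) = 0 := by
  constructor
  · intro h0 c hc
    refine Lf_mul_sum h q c n hc fun m hm => ?_
    rw [← Aop_mulVec d n q h ⟨m, by omega⟩, h0]; rfl
  · intro h0
    funext m
    rw [Aop_mulVec]
    exact h0 _ (by simpa using Nat.lt_succ_iff.1 m.2)

lemma Aop_right_inv {d n : ℕ} {q : Polynomial ℂ} (hq : q ≠ 0) (hd : q.natDegree + n ≤ d) :
    ∃ B : Matrix (Fin (d+1)) (Fin (n+1)) ℂ, Aop d n q * B = 1 := by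
  obtain ⟨C, hC⟩ := left_inv_matrix (Aop d n q).transpose (by
    intro x hx
    have : pol x = 0 := by
      have h2 : q * pol x = 0 := by
        rw [← pol_vec (natDegree_mul_le_of hd (natDegree_pol_le x))]
        have h3 : vec d (q * pol x) = 0 := by
          funext l
          have := congrFun hx l
          simp only [Matrix.mulVec, dotProduct, Matrix.transpose_apply, Aop, Pi.zero_apply] at this
          have h4 : wt d l * (q * pol x).coeff l = 0 := by
            rw [← this, pol, Finset.mul_sum, Polynomial.finsetSum_coeff, Finset.mul_sum]
            refine Finset.sum_congr rfl fun m _ => ?_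
            rw [mul_left_comm q, Polynomial.coeff_C_mul]; ring
          exact (mul_eq_zero.1 h4).resolve_left (wt_ne_zero d l)
        rw [h3]; simp [pol]
      exact (mul_eq_zero.1 h2).resolve_left hq
    rw [← vec_pol x, this]; rfl)
  refine ⟨C.transpose, ?_⟩
  have := congrArg Matrix.transpose hC
  rwa [Matrix.transpose_mul, Matrix.transpose_transpose, Matrix.transpose_one] at this

def Cat (d M : ℕ) (h : Fin (d+1) → ℂ) : Matrix (Fin (d - M + 1)) (Fin (M+1)) ℂ :=
  fun a b => Lf d h (Polynomial.X ^ ((a : ℕ) + (b : ℕ)))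

lemma Cat_mulVec (d M : ℕ) (h : Fin (d+1) → ℂ) (x : Fin (M+1) → ℂ) (a : Fin (d - M + 1)) :
    (Cat d M h).mulVec x a = Lf d h (pol x * Polynomial.X ^ (a : ℕ)) := by
  rw [Lf_pol_mul]
  simp only [Matrix.mulVec, dotProduct, Cat]
  refine Finset.sum_congr rfl fun i _ => ?_
  rw [← pow_add, mul_comm, add_comm]

lemma ND_of_det {d M : ℕ} {h : Fin (d+1) → ℂ} (L : Matrix (Fin (M+1)) (Fin (d - M + 1)) ℂ)
    (hL : (L * Cat d M h).det ≠ 0) : ND d M h := by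
  intro p hp0 hp
  by_contra hcon
  push Not at hcon
  have h1 : (Cat d M h).mulVec (vec M p) = 0 := by
    funext a
    rw [Cat_mulVec, pol_vec hp]
    exact hcon _ (by simpa using Nat.lt_succ_iff.1 a.2)
  have h2 : (L * Cat d M h).mulVec (vec M p) = 0 := by rw [← Matrix.mulVec_mulVec, h1, Matrix.mulVec_zero]
  have := Matrix.eq_zero_of_mulVec_eq_zero hL h2
  apply hp0
  rw [← pol_vec hp, this]; simp [pol]

lemma ND_left_inv {d M : ℕ} {h : Fin (d+1) → ℂ} (hh : ND d M h) : ∃ L : Matrix (Fin (M+1)) (Fin (d - M + 1)) ℂ, L * Cat d M h = 1 := by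
  apply left_inv_matrix
  intro x hx
  by_contra hx0
  have hp : pol x ≠ 0 := by
    intro h0; apply hx0; rw [← vec_pol x, h0]; rfl
  obtain ⟨s, hs, hne⟩ := hh (pol x) hp (natDegree_pol_le x)
  apply hne
  refine Lf_mul_sum h _ s _ hs fun m hm => ?_
  rw [← Cat_mulVec d M h x ⟨m, by omega⟩, hx]; rfl

lemma P1_matmul {a b c : Type} [Fintype b] {A : ℂ → Matrix a b ℂ} {B : ℂ → Matrix b c ℂ}
    (hA : ∀ i j, (fun s => A s i j) ∈ P1) (hB : ∀ i j, (fun s => B s i j) ∈ P1) (i : a) (j : c) :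
    (fun s => (A s * B s) i j) ∈ P1 := by
  simp only [Matrix.mul_apply]
  exact P1_sum _ fun k _ => P1_mul (hA _ _) (hB _ _)

lemma P1_mulVec {a b : Type} [Fintype b] {A : ℂ → Matrix a b ℂ} {x : ℂ → b → ℂ}
    (hA : ∀ i j, (fun s => A s i j) ∈ P1) (hx : ∀ i, (fun s => x s i) ∈ P1) (i : a) :
    (fun s => ((A s).mulVec (x s)) i) ∈ P1 := by
  simp only [Matrix.mulVec, dotProduct]
  exact P1_sum _ fun k _ => P1_mul (hA _ _) (hx _)

lemma P1_adjugate {κ : Type} [Fintype κ] [DecidableEq κ] (A : ℂ → Matrix κ κ ℂ)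
    (h : ∀ i j, (fun s => A s i j) ∈ P1) (i j : κ) : (fun s => (A s).adjugate i j) ∈ P1 := by
  simp only [Matrix.adjugate_apply]
  apply P1_det
  intro a b
  simp only [Matrix.updateRow_apply]
  split_ifs
  · exact P1_const _
  · exact h _ _

lemma density {d e n M : ℕ} (hd : d = e + n) (hM : M < e) (hMn : M ≤ n) (κ : Fin n → ℕ) (hκ : ∑ i, κ i = e)
    (D : MvPolynomial (Fin n ⊕ Fin n) ℂ) (hD : ∃ u v, (∀ i, v i ≠ 0) ∧ eval (Sum.elim u v) D ≠ 0)
    (Q : Set (Fin (d+1) → ℂ))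
    (hQ : ∀ (u v : Fin n → ℂ) (h : Fin (d+1) → ℂ), (∀ i, v i ≠ 0) → eval (Sum.elim u v) D ≠ 0 →
      (∀ c : Polynomial ℂ, c.natDegree ≤ n → Lf d h (prodL κ u v * c) = 0) → ND d M h → h ∈ Q)
    (u0 v0 : Fin n → ℂ) (h0 : Fin (d+1) → ℂ) (hnz : ∀ i, u0 i ≠ 0 ∨ v0 i ≠ 0)
    (hk : ∀ c : Polynomial ℂ, c.natDegree ≤ n → Lf d h0 (prodL κ u0 v0 * c) = 0) : h0 ∈ zClosure Q := by
  intro P hP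
  obtain ⟨u1, v1, hv1, hD1⟩ := hD
  let U : ℂ → Fin n → ℂ := fun s i => (1 - s) * u0 i + s * u1 i
  let V : ℂ → Fin n → ℂ := fun s i => (1 - s) * v0 i + s * v1 i
  have hU : ∀ i, (fun s => U s i) ∈ P1 := fun i => P1_line _ _
  have hV : ∀ i, (fun s => V s i) ∈ P1 := fun i => P1_line _ _
  have hU0 : U 0 = u0 := by funext i; simp [U]
  have hV0 : V 0 = v0 := by funext i; simp [V]
  have hU1 : U 1 = u1 := by funext i; simp [U]
  have hV1 : V 1 = v1 := by funext i; simp [V]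
  let A : ℂ → Matrix (Fin (n+1)) (Fin (d+1)) ℂ := fun s => Aop d n (prodL κ (U s) (V s))
  have hA : ∀ i j, (fun s => A s i j) ∈ P1 := fun i j =>
    P1_mul (P1_const _) (PC_mul (PC_prodL κ hU hV) (PC_const _) _)
  obtain ⟨B, hB⟩ := Aop_right_inv (d := d) (n := n) (prodL_ne_zero κ hnz)
    (by have := natDegree_prodL_le κ u0 v0; omega)
  have hAB : ∀ i j, (fun s => (A s * B) i j) ∈ P1 := P1_matmul hA (fun i j => P1_const _)
  have hA0B : A 0 * B = 1 := by simp only [A, hU0, hV0, hB]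
  let δ : ℂ → ℂ := fun s => (A s * B).det
  have hδ : δ ∈ P1 := P1_det _ hAB
  let g0 : ℂ → ℂ := fun s => s * ((∏ i, V s i) * eval (Sum.elim (U s) (V s)) D)
  have hg0 : g0 ∈ P1 := by
    refine P1_mul P1_id (P1_mul (P1_prod _ fun i _ => hV i) (P1_eval (fun s => Sum.elim (U s) (V s)) ?_ _))
    rintro (i | i)
    · exact hU i
    · exact hV i
  obtain ⟨s1, hs1, hgs1⟩ := P1_both hδ hg0 (s0 := 0) (s1 := 1) (by simp [δ, hA0B]) (by
    simp only [g0, hU1, hV1]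
    exact mul_ne_zero one_ne_zero (mul_ne_zero (Finset.prod_ne_zero_iff.2 fun i _ => hv1 i) hD1))
  have hVs1 : ∀ i, V s1 i ≠ 0 := fun i => Finset.prod_ne_zero_iff.1
    (left_ne_zero_of_mul (right_ne_zero_of_mul hgs1)) i (Finset.mem_univ _)
  have hs10 : s1 ≠ 0 := left_ne_zero_of_mul hgs1
  obtain ⟨y1, hy1, hy1N⟩ := special hd hM hMn (prodL κ (U s1) (V s1)) (by rw [natDegree_prodL_eq _ _ _ hVs1, hκ])
  let y : ℂ → Fin (d+1) → ℂ := fun s l => (1 - s / s1) * h0 l + (s / s1) * y1 l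
  have hy : ∀ l, (fun s => y s l) ∈ P1 := by
    intro l
    simp only [y, div_eq_mul_inv]
    exact P1_add (P1_mul (P1_sub (P1_const 1) (P1_mul P1_id (P1_const _))) (P1_const _))
      (P1_mul (P1_mul P1_id (P1_const _)) (P1_const _))
  have hy0 : y 0 = h0 := by funext l; simp [y]
  have hys1 : y s1 = y1 := by funext l; simp [y, hs10]
  let H : ℂ → Fin (d+1) → ℂ := fun s => δ s • y s - B.mulVec ((A s * B).adjugate.mulVec ((A s).mulVec (y s)))
  have hH : ∀ l, (fun s => H s l) ∈ P1 := by
    intro l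
    exact P1_sub (P1_mul hδ (hy l)) (P1_mulVec (A := fun _ => B) (fun i j => P1_const _)
      (P1_mulVec (P1_adjugate _ hAB) (P1_mulVec hA hy)) l)
  have hHk : ∀ s, (A s).mulVec (H s) = 0 := by
    intro s
    simp only [H, Matrix.mulVec_sub, Matrix.mulVec_smul]
    rw [Matrix.mulVec_mulVec, Matrix.mulVec_mulVec, Matrix.mul_adjugate, Matrix.smul_mulVec, Matrix.one_mulVec]
    exact sub_self _
  have hH0 : H 0 = h0 := by
    have : (A 0).mulVec h0 = 0 := by
      simp only [A, hU0, hV0]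
      exact (Aop_zero_iff _ _ _ _).2 hk
    simp only [H, hy0, this, Matrix.mulVec_zero, sub_zero, δ, hA0B, Matrix.det_one, one_smul]
  have hHs1 : H s1 = δ s1 • y1 := by
    have : (A s1).mulVec y1 = 0 := (Aop_zero_iff _ _ _ _).2 hy1
    simp only [H, hys1, this, Matrix.mulVec_zero, sub_zero]
  have hNs1 : ND d M (H s1) := by
    rw [hHs1]
    intro p hp0 hp
    obtain ⟨s, hs, hne⟩ := hy1N p hp0 hp
    exact ⟨s, hs, by rw [Lf_smul]; exact mul_ne_zero hs1 hne⟩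
  obtain ⟨L, hL⟩ := ND_left_inv hNs1
  have hcat : (fun s => (L * Cat d M (H s)).det) ∈ P1 := by
    apply P1_det
    refine P1_matmul (A := fun _ => L) (B := fun s => Cat d M (H s)) (fun i j => P1_const _) ?_
    intro a b
    simp only [Cat, Lf_eq]
    exact P1_sum _ fun l _ => P1_mul (P1_const _) (hH l)
  have := P1_dense (P1_eval H hH P) (P1_mul hg0 hcat) s1
    (mul_ne_zero hgs1 (by rw [hL, Matrix.det_one]; exact one_ne_zero)) (by
      intro s hs
      apply hP
      have hgs := left_ne_zero_of_mul hs
      refine hQ (U s) (V s) (H s) ?_ ?_ ?_ (ND_of_det L (right_ne_zero_of_mul hs))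
      · exact fun i => Finset.prod_ne_zero_iff.1 (left_ne_zero_of_mul (right_ne_zero_of_mul hgs)) i (Finset.mem_univ _)
      · exact right_ne_zero_of_mul (right_ne_zero_of_mul hgs)
      · exact (Aop_zero_iff _ _ _ _).1 (hHk s)) 0
  rwa [hH0] at this

/-- stacked square matrix -/
def stk {R : Type} {k m N : ℕ} (e : Fin N ≃ Fin k ⊕ Fin m) (A : Fin k → Fin N → R) (Y : Fin m → Fin N → R) :
    Matrix (Fin k ⊕ Fin m) (Fin k ⊕ Fin m) R := fun x y => Sum.elim A Y x (e.symm y)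

/-- the polarised Plücker form -/
def plF {R : Type} [CommRing R] {k m N : ℕ} (e : Fin N ≃ Fin k ⊕ Fin m) (p : (Fin k → Fin N) → R)
    (Y : Fin m → Fin N → R) : R :=
  ∑ s : Fin k → Fin N, p s * (stk e (fun a => Pi.single (s a) 1) Y).det

lemma stk_perm {k m N : ℕ} (e : Fin N ≃ Fin k ⊕ Fin m) (A : Fin k → Fin N → ℂ) (Y : Fin m → Fin N → ℂ)
    (σ : Equiv.Perm (Fin k)) :
    (stk e (fun i => A (σ i)) Y).det = ((Equiv.Perm.sign σ : ℤ) : ℂ) * (stk e A Y).det := by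
  have := Matrix.det_permute (σ.sumCongr 1) (stk e A Y)
  rw [Equiv.Perm.sign_sumCongr, map_one, mul_one] at this
  rw [← this]
  congr 1
  funext x y
  rcases x with x | x <;> rfl

lemma stk_expand {k m N : ℕ} (e : Fin N ≃ Fin k ⊕ Fin m) (A : Fin k → Fin N → ℂ) (Y : Fin m → Fin N → ℂ) :
    (stk e A Y).det = ∑ s : Fin k → Fin N, (∏ i, A i (s i)) * (stk e (fun a => Pi.single (s a) 1) Y).det := by
  let D : MultilinearMap ℂ (fun _ : Fin k ⊕ Fin m => (Fin k ⊕ Fin m → ℂ)) ℂ :=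
    (Matrix.detRowAlternating (R := ℂ) (n := Fin k ⊕ Fin m)).toMultilinearMap
  have key : ∀ B : Fin k → Fin N → ℂ, (stk e B Y).det =
      D.currySum (fun i => fun y => B i (e.symm y)) (fun b y => Y b (e.symm y)) := by
    intro B
    rw [MultilinearMap.currySum_apply]
    show _ = Matrix.det _
    congr 1
    funext x y
    rcases x with x | x <;> rfl
  simp only [key]
  have hA : (fun i => fun y => A i (e.symm y)) = fun i => ∑ l : Fin N, A i l • (fun y : Fin k ⊕ Fin m => (Pi.single l 1 : Fin N → ℂ) (e.symm y)) := by
    funext i y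
    simp [Finset.sum_apply, Pi.single_apply]
  rw [hA, MultilinearMap.map_sum, MultilinearMap.sum_apply]
  refine Finset.sum_congr rfl fun s _ => ?_
  rw [MultilinearMap.map_smul_univ]
  rfl

lemma plF_plucker {k m N : ℕ} (e : Fin N ≃ Fin k ⊕ Fin m) (M : Matrix (Fin k) (Fin N) ℂ) (Y : Fin m → Fin N → ℂ) :
    plF e (plucker M) Y = (k.factorial : ℂ) * (stk e M Y).det := by
  have h1 : ∀ s, plucker M s = ∑ σ : Equiv.Perm (Fin k), ((Equiv.Perm.sign σ : ℤ) : ℂ) * ∏ i, M (σ i) (s i) := by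
    intro s
    rw [plucker, Matrix.det_apply']
    rfl
  simp only [plF, h1, Finset.sum_mul]
  rw [Finset.sum_comm]
  have : ∀ σ : Equiv.Perm (Fin k), (∑ s : Fin k → Fin N, ((Equiv.Perm.sign σ : ℤ) : ℂ) * (∏ i, M (σ i) (s i)) *
      (stk e (fun a => Pi.single (s a) 1) Y).det) = (stk e M Y).det := by
    intro σ
    simp only [mul_assoc]
    rw [← Finset.mul_sum, ← stk_expand e (fun i => M (σ i)) Y]
    rw [stk_perm e M Y σ, ← mul_assoc]
    have : ((Equiv.Perm.sign σ : ℤ) : ℂ) * ((Equiv.Perm.sign σ : ℤ) : ℂ) = 1 := by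
      rw [← Int.cast_mul, ← Units.val_mul, Int.units_mul_self]; simp
    rw [this, one_mul]
  simp only [this]
  simp [Fintype.card_perm]

lemma plF_map {R S : Type} [CommRing R] [CommRing S] (f : R →+* S) {k m N : ℕ} (e : Fin N ≃ Fin k ⊕ Fin m)
    (p : (Fin k → Fin N) → R) (Y : Fin m → Fin N → R) :
    f (plF e p Y) = plF e (fun s => f (p s)) (fun b l => f (Y b l)) := by
  simp only [plF, map_sum, map_mul, RingHom.map_det]
  refine Finset.sum_congr rfl fun s _ => ?_
  congr 2
  funext x y
  rcases x with x | x
  · simp only [stk, RingHom.mapMatrix_apply, Matrix.map_apply, Sum.elim_inl, Pi.single_apply]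
    split_ifs <;> simp
  · rfl

lemma plF_scale {R : Type} [CommRing R] {k m N : ℕ} (e : Fin N ≃ Fin k ⊕ Fin m)
    (p : (Fin k → Fin N) → R) (Y : Fin m → Fin N → R) (τ : Fin m → R) :
    plF e p (fun b l => τ b * Y b l) = (∏ b, τ b) * plF e p Y := by
  simp only [plF, Finset.mul_sum]
  refine Finset.sum_congr rfl fun s _ => ?_
  have := Matrix.det_mul_column (Sum.elim (fun _ => 1) τ) (stk e (fun a => Pi.single (s a) 1) Y)
  rw [Fintype.prod_sum_type] at this
  simp only [Sum.elim_inl, Sum.elim_inr, Finset.prod_const_one, one_mul] at this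
  rw [mul_left_comm, ← this]
  congr 2
  funext x y
  rcases x with x | x <;> simp [stk]

/-- rows given by coefficients of products of powers of linear forms -/
def rowR {R : Type} [CommRing R] (g : ℂ →+* R) {n : ℕ} (N : ℕ) (μ : Fin n → ℕ) (c : Polynomial ℂ) (u v : Fin n → R) : Fin N → R :=
  fun l => ((∏ i, (Polynomial.C (u i) + Polynomial.C (v i) * Polynomial.X) ^ μ i) * c.map g).coeff l

lemma rowR_map {R S : Type} [CommRing R] [CommRing S] (f : R →+* S) (g : ℂ →+* R) {n : ℕ} (N : ℕ) (μ : Fin n → ℕ)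
    (c : Polynomial ℂ) (u v : Fin n → R) (l : Fin N) :
    f (rowR g N μ c u v l) = rowR (f.comp g) N μ c (fun i => f (u i)) (fun i => f (v i)) l := by
  simp only [rowR]
  rw [← Polynomial.coeff_map]
  simp [Polynomial.map_prod, Polynomial.map_map]

lemma rowR_scale {R : Type} [CommRing R] (g : ℂ →+* R) {n : ℕ} (N : ℕ) (μ : Fin n → ℕ)
    (c : Polynomial ℂ) (u v t : Fin n → R) (l : Fin N) :
    rowR g N μ c (fun i => t i * u i) (fun i => t i * v i) l = (∏ i, t i ^ μ i) * rowR g N μ c u v l := by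
  simp only [rowR]
  rw [← Polynomial.coeff_C_mul]
  congr 1
  rw [← mul_assoc]
  congr 1
  rw [map_prod, ← Finset.prod_mul_distrib]
  refine Finset.prod_congr rfl fun i _ => ?_
  rw [map_pow, ← mul_pow]
  congr 1
  simp only [map_mul]
  ring

lemma rowR_id {n : ℕ} (N : ℕ) (μ : Fin n → ℕ) (c : Polynomial ℂ) (u v : Fin n → ℂ) :
    rowR (RingHom.id ℂ) (N+1) μ c u v = vec N (prodL μ u v * c) := by
  funext l
  simp [rowR, vec, prodL, lin]

/-- the universal equations -/
def EqP {k m N n : ℕ} (e : Fin N ≃ Fin k ⊕ Fin m) (μ : Fin m → Fin n → ℕ) (c : Fin m → Polynomial ℂ) :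
    MvPolynomial ((Fin k → Fin N) ⊕ (Fin n ⊕ Fin n)) ℂ :=
  plF e (fun s => X (Sum.inl s)) (fun b => rowR C N (μ b) (c b) (fun i => X (Sum.inr (Sum.inl i))) (fun i => X (Sum.inr (Sum.inr i))))

lemma EqP_eval₂ {K : Type} [Field K] (g : ℂ →+* K) {k m N n : ℕ} (e : Fin N ≃ Fin k ⊕ Fin m) (μ : Fin m → Fin n → ℕ)
    (c : Fin m → Polynomial ℂ) (x : (Fin k → Fin N) → K) (u v : Fin n → K) :
    eval₂ g (Sum.elim x (Sum.elim u v)) (EqP e μ c) = plF e x (fun b => rowR g N (μ b) (c b) u v) := by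
  have := plF_map (eval₂Hom g (Sum.elim x (Sum.elim u v))) e (fun s => X (Sum.inl s)) (fun b => rowR C N (μ b) (c b) (fun i => X (Sum.inr (Sum.inl i))) (fun i => X (Sum.inr (Sum.inr i))))
  simp only [rowR_map] at this
  have h2 : (eval₂Hom g (Sum.elim x (Sum.elim u v))).comp C = g := by ext a; simp
  rw [h2] at this
  simpa [EqP] using this

lemma EqP_eval {k m N n : ℕ} (e : Fin (N+1) ≃ Fin k ⊕ Fin m) (μ : Fin m → Fin n → ℕ)
    (c : Fin m → Polynomial ℂ) (x : (Fin k → Fin (N+1)) → ℂ) (u v : Fin n → ℂ) :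
    eval (Sum.elim x (Sum.elim u v)) (EqP e μ c) = plF e x (fun b => vec N (prodL (μ b) u v * c b)) := by
  have := EqP_eval₂ (RingHom.id ℂ) e μ c x u v
  simp only [rowR_id] at this
  rw [← this]; rfl

lemma EqP_hom {K : Type} [Field K] (g : ℂ →+* K) {k m N n : ℕ} (e : Fin N ≃ Fin k ⊕ Fin m) (μ : Fin m → Fin n → ℕ)
    (c : Fin m → Polynomial ℂ) (x : (Fin k → Fin N) → K) (u v t : Fin n → K)
    (h : eval₂ g (Sum.elim x (Sum.elim u v)) (EqP e μ c) = 0) :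
    eval₂ g (Sum.elim x (Sum.elim (fun i => t i * u i) (fun i => t i * v i))) (EqP e μ c) = 0 := by
  rw [EqP_eval₂] at h ⊢
  have : (fun b => rowR g N (μ b) (c b) (fun i => t i * u i) (fun i => t i * v i)) =
      fun b l => (∏ i, t i ^ μ b i) * rowR g N (μ b) (c b) u v l := by
    funext b l; rw [rowR_scale]
  rw [this, plF_scale, h, mul_zero]

lemma stk_indep {k m N : ℕ} (e : Fin N ≃ Fin k ⊕ Fin m) (A : Fin k → Fin N → ℂ) (Y : Fin m → Fin N → ℂ) :
    (stk e A Y).det ≠ 0 ↔ LinearIndependent ℂ (Sum.elim A Y) := by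
  rw [← isUnit_iff_ne_zero, ← Matrix.isUnit_iff_isUnit_det, ← Matrix.linearIndependent_rows_iff_isUnit]
  have : (stk e A Y).row = (LinearEquiv.funCongrLeft ℂ ℂ e.symm).toLinearMap ∘ Sum.elim A Y := by
    funext x y
    rcases x with x | x <;> rfl
  rw [this, LinearMap.linearIndependent_iff]
  exact LinearEquiv.ker _

lemma exists_compl {k m N : ℕ} (e : Fin N ≃ Fin k ⊕ Fin m) (M : Matrix (Fin k) (Fin N) ℂ)
    (hk : Module.finrank ℂ (rowSpan M) = k) (T : Submodule ℂ (Fin N → ℂ)) (hT : rowSpan M ⊔ T = ⊤) :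
    ∃ Y : Fin m → Fin N → ℂ, (∀ b, Y b ∈ T) ∧ (stk e M Y).det ≠ 0 := by
  have hN : N = k + m := by simpa using Fintype.card_congr e
  have hq : Module.finrank ℂ ((Fin N → ℂ) ⧸ rowSpan M) = m := by
    have := Submodule.finrank_quotient_add_finrank (rowSpan M)
    rw [hk, Module.finrank_fin_fun] at this
    omega
  let B := Module.finBasisOfFinrankEq ℂ _ hq
  have hsurj : ∀ q : (Fin N → ℂ) ⧸ rowSpan M, ∃ y ∈ T, Submodule.Quotient.mk y = q := by
    intro q
    obtain ⟨x, rfl⟩ := Submodule.Quotient.mk_surjective _ q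
    have hx : x ∈ rowSpan M ⊔ T := by rw [hT]; trivial
    obtain ⟨w, hw, y, hy, rfl⟩ := Submodule.mem_sup.1 hx
    refine ⟨y, hy, ?_⟩
    rw [Submodule.Quotient.eq]
    simpa using hw
  choose f hfT hf using hsurj
  refine ⟨fun b => f (B b), fun b => hfT _, ?_⟩
  refine (stk_indep e (fun i => M i) _).2 ?_
  have hMi : LinearIndependent ℂ (fun i => M i) := by
    rw [linearIndependent_iff_card_eq_finrank_span, Fintype.card_fin]
    exact hk.symm
  have hM' : LinearIndependent ℂ (fun i => (⟨M i, Submodule.subset_span ⟨i, rfl⟩⟩ : rowSpan M)) := by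
    apply LinearIndependent.of_comp (rowSpan M).subtype
    exact hMi
  refine hM'.sumElim_of_quotient (fun b => f (B b)) ?_
  have : (Submodule.Quotient.mk (p := rowSpan M) ∘ fun b => f (B b)) = B := by
    funext b; exact hf _
  rw [this]
  exact B.linearIndependent

lemma mem_of_dets {k m N : ℕ} (e : Fin N ≃ Fin k ⊕ Fin m) (M : Matrix (Fin k) (Fin N) ℂ)
    (hk : Module.finrank ℂ (rowSpan M) = k) (y : Fin N → ℂ)
    (h : ∀ (Z : Fin m → Fin N → ℂ) (b : Fin m), (stk e M (Function.update Z b y)).det = 0) : y ∈ rowSpan M := by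
  obtain ⟨Z, -, hZ⟩ := exists_compl e M hk ⊤ (by simp)
  have hind := (stk_indep e M Z).1 hZ
  have hspan := hind.span_eq_top_of_card_eq_finrank' (by
    have : N = k + m := by simpa using Fintype.card_congr e
    simp [this])
  have hy : y ∈ Submodule.span ℂ (Set.range (Sum.elim (fun i => M i) Z)) := by
    have : Sum.elim (fun i => M i) Z = Sum.elim M Z := rfl
    rw [this, hspan]; trivial
  obtain ⟨c, hc⟩ := (Submodule.mem_span_range_iff_exists_fun ℂ).1 hy
  have h0 : ∀ b, c (Sum.inr b) = 0 := by
    intro b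
    have h1 := Matrix.det_updateRow_sum (stk e M Z) (Sum.inr b) c
    have h2 : (stk e M Z).updateRow (Sum.inr b) (∑ k, c k • (stk e M Z) k) = stk e M (Function.update Z b y) := by
      funext x z
      rw [Matrix.updateRow_apply]
      rcases x with x | x
      · rw [if_neg (by simp)]; rfl
      · by_cases hx : x = b
        · subst hx
          rw [if_pos rfl]
          show _ = Function.update Z x y x (e.symm z)
          rw [Function.update_self, ← hc]
          simp only [Finset.sum_apply, Pi.smul_apply]
          rfl
        · rw [if_neg (by simpa using hx)]
          show Z x (e.symm z) = Function.update Z b y x (e.symm z)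
          rw [Function.update_of_ne hx]
    rw [h2, h] at h1
    simpa [hZ] using h1.symm
  rw [← hc, Fintype.sum_sum_type]
  simp only [h0, zero_smul, Finset.sum_const_zero, add_zero, Sum.elim_inl]
  exact Submodule.sum_mem _ fun i _ => Submodule.smul_mem _ _ (Submodule.subset_span ⟨i, rfl⟩)

lemma det_zero_of_mem {k m N : ℕ} (e : Fin N ≃ Fin k ⊕ Fin m) (M : Matrix (Fin k) (Fin N) ℂ)
    (Y : Fin m → Fin N → ℂ) (b : Fin m) (hy : Y b ∈ rowSpan M) : (stk e M Y).det = 0 := by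
  by_contra h
  have hind := (stk_indep e M Y).1 h
  have := hind.notMem_span_image (s := Set.range Sum.inl) (x := Sum.inr b) (by simp)
  apply this
  rw [← Set.range_comp]
  exact hy

lemma det_zero_of_dim {k m N : ℕ} (e : Fin N ≃ Fin k ⊕ Fin m) (M : Matrix (Fin k) (Fin N) ℂ)
    (Y : Fin m → Fin N → ℂ) (T : Submodule ℂ (Fin N → ℂ)) (hY : ∀ b, Y b ∈ T) (hT : rowSpan M ⊔ T ≠ ⊤) :
    (stk e M Y).det = 0 := by
  by_contra h
  have hind := (stk_indep e M Y).1 h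
  have hspan := hind.span_eq_top_of_card_eq_finrank' (by
    have : N = k + m := by simpa using Fintype.card_congr e
    simp [this])
  apply hT
  rw [eq_top_iff, ← hspan, Submodule.span_le]
  rintro _ ⟨x | x, rfl⟩
  · exact Submodule.mem_sup_left (Submodule.subset_span ⟨x, rfl⟩)
  · exact Submodule.mem_sup_right (hY x)

lemma CH_decode {r n k m j : ℕ} {lam : Fin n → ℕ} (hn : 0 < n) (hl : ∑ i, lam i = r) (h1 : ∀ i, 1 ≤ lam i)
    (hkm : k + m = r + 1) (hkn : k + n = r + j)
    (M : Matrix (Fin k) (Fin (r+1)) ℂ) (hfin : Module.finrank ℂ (rowSpan M) = k)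
    (hM : plucker M ∈ zClosure (smoothCHCone r (crlCone r n lam) (n+1) k j)) :
    ∃ u v : Fin n → ℂ, (∀ i, u i ≠ 0 ∨ v i ≠ 0) ∧ vec r (prodL lam u v) ∈ rowSpan M ∧
      rowSpan M ⊔ LinearMap.range (mulMap r n (prodL (fun i => lam i - 1) u v)) ≠ ⊤ := by
  let e : Fin (r+1) ≃ Fin k ⊕ Fin m := (finCongr hkm.symm).trans finSumFinEquiv.symm
  let EE : Set (MvPolynomial ((Fin k → Fin (r+1)) ⊕ (Fin n ⊕ Fin n)) ℂ) :=
    {E | (∃ (Z : Fin m → Fin (r+1) → ℂ) (b : Fin m),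
        E = EqP e (Function.update (fun _ _ => 0) b lam) (Function.update (fun b => pol (Z b)) b 1)) ∨
      ∃ c : Fin m → Polynomial ℂ, (∀ b, (c b).natDegree ≤ n) ∧ E = EqP e (fun _ i => lam i - 1) c}
  have hrow : ∀ (u v : Fin n → ℂ) (Z : Fin m → Fin (r+1) → ℂ) (b : Fin m),
      (fun b' => vec r (prodL ((Function.update (fun _ _ => 0) b lam : Fin m → Fin n → ℕ) b') u v *
        (Function.update (fun b => pol (Z b)) b 1 : Fin m → Polynomial ℂ) b')) =
      Function.update Z b (vec r (prodL lam u v)) := by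
    intro u v Z b
    funext b'
    by_cases hb : b' = b
    · subst hb; simp
    · simp only [Function.update_of_ne hb]
      simp [prodL, vec_pol]
  obtain ⟨u, v, hnz, hE⟩ := elim_closed EE (by
      rintro E hE K _ g x u v c - h0
      rcases hE with ⟨Z, b, rfl⟩ | ⟨c, -, rfl⟩ <;> exact EqP_hom g e _ _ x u v _ h0)
    (smoothCHCone r (crlCone r n lam) (n+1) k j) (by
      rintro _ ⟨A, rfl, hA, x, hx0, hxS, hxd, hxA, hxj⟩
      obtain ⟨t, u, v, hx⟩ := (crl_iff hl x).1 hxS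
      obtain ⟨ht, hnz⟩ := nz_of_pol h1 x t u v hx hx0
      refine ⟨u, v, hnz, ?_⟩
      have htan := tan_eq hn hl h1 x t u v hx hx0 hxd.le
      rintro E (⟨Z, b, rfl⟩ | ⟨c, hc, rfl⟩)
      · rw [EqP_eval, plF_plucker, hrow, det_zero_of_mem e A _ b, mul_zero]
        rw [Function.update_self]
        have : vec r (prodL lam u v) = t⁻¹ • x := by
          have h2 : x = t • vec r (prodL lam u v) := by
            rw [← vec_pol x, hx]
            funext l
            simp [vec]
          rw [h2, smul_smul, inv_mul_cancel₀ ht, one_smul]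
        rw [this]
        exact Submodule.smul_mem _ _ hxA
      · rw [EqP_eval, plF_plucker, det_zero_of_dim e A _ (LinearMap.range (mulMap r n (prodL (fun i => lam i - 1) u v))), mul_zero]
        · intro b
          refine ⟨vec n (c b), ?_⟩
          rw [mulMap_apply, pol_vec (hc b)]
        · intro htop
          rw [span_zTangentAt, htan] at hxj
          have h2 := Submodule.finrank_sup_add_finrank_inf_eq (rowSpan A) (LinearMap.range (mulMap r n (prodL (fun i => lam i - 1) u v)))
          rw [htop, finrank_top, Module.finrank_fin_fun, hA, finrank_mulMap (natDegree_G hl h1 u v) (prodL_ne_zero _ hnz)] at h2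
          omega)
    (plucker M) hM
  have hkf : (k.factorial : ℂ) ≠ 0 := by exact_mod_cast k.factorial_ne_zero
  refine ⟨u, v, hnz, ?_, ?_⟩
  · apply mem_of_dets e M hfin
    intro Z b
    have := hE _ (Or.inl ⟨Z, b, rfl⟩)
    rw [EqP_eval, plF_plucker, hrow] at this
    exact (mul_eq_zero.1 this).resolve_left hkf
  · intro htop
    obtain ⟨Y, hY, hdet⟩ := exists_compl e M hfin _ htop
    choose c hc using hY
    apply hdet
    have := hE _ (Or.inr ⟨fun b => pol (c b), fun b => natDegree_pol_le _, rfl⟩)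
    rw [EqP_eval, plF_plucker] at this
    have h2 := (mul_eq_zero.1 this).resolve_left hkf
    rw [← h2]
    congr 2
    funext b
    rw [← hc b, mulMap_apply]

lemma ev_exists {u v : ℂ} (h : u ≠ 0 ∨ v ≠ 0) : ∃ ev : ℕ → Polynomial ℂ →ₗ[ℂ] ℂ,
    (∀ M p, p.natDegree ≤ M → ev M p = 0 → ∃ q, p = lin u v * q ∧ (q = 0 ∨ q.natDegree + 1 ≤ M)) ∧
    ∀ e M, e ≤ M → ∃ c0 : Polynomial ℂ, c0.natDegree + e ≤ M ∧ ∀ p, p.natDegree ≤ e → ev M (p * c0) = ev e p := by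
  by_cases hv : v = 0
  · have hu : u ≠ 0 := h.resolve_right (by simp [hv])
    refine ⟨fun M => Polynomial.lcoeff ℂ M, ?_, ?_⟩
    · intro M p hp h0
      refine ⟨Polynomial.C u⁻¹ * p, ?_, ?_⟩
      · rw [lin, hv, map_zero, zero_mul, add_zero, ← mul_assoc, ← Polynomial.C_mul, mul_inv_cancel₀ hu, Polynomial.C_1, one_mul]
      · rw [Polynomial.natDegree_C_mul (inv_ne_zero hu)]
        by_cases hp0 : p = 0
        · left; simp [hp0]
        · right
          by_contra hlt
          have : p.natDegree = M := by omega
          apply hp0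
          rw [← Polynomial.leadingCoeff_eq_zero, Polynomial.leadingCoeff, this]
          exact h0
    · intro e M heM
      refine ⟨Polynomial.X ^ (M - e), by rw [Polynomial.natDegree_X_pow]; omega, ?_⟩
      intro p hp
      simp only [Polynomial.lcoeff_apply]
      have := Polynomial.coeff_mul_X_pow p (M - e) e
      rwa [Nat.add_sub_cancel' heM] at this
  · refine ⟨fun M => Polynomial.leval (-u/v), ?_, ?_⟩
    · intro M p hp h0
      obtain ⟨q, hq⟩ := Polynomial.dvd_iff_isRoot.2 (show p.IsRoot (-u/v) from h0)
      refine ⟨Polynomial.C v⁻¹ * q, ?_, ?_⟩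
      · rw [hq, ← mul_assoc]
        congr 1
        rw [lin, add_mul, mul_right_comm, ← Polynomial.C_mul, ← Polynomial.C_mul, mul_inv_cancel₀ hv, Polynomial.C_1, one_mul,
          ← div_eq_mul_inv, neg_div, Polynomial.C_neg]
        ring
      · by_cases hq0 : q = 0
        · left; simp [hq0]
        · right
          rw [Polynomial.natDegree_C_mul (inv_ne_zero hv)]
          rw [hq, Polynomial.natDegree_mul (Polynomial.X_sub_C_ne_zero _) hq0, Polynomial.natDegree_X_sub_C] at hp
          omega
    · intro e M heM
      exact ⟨1, by simpa using heM, fun p _ => by simp⟩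

lemma div_or {u v : ℂ} (hnz : u ≠ 0 ∨ v ≠ 0) {e M : ℕ} (heM : e ≤ M) (h : Polynomial ℂ) (h0 : h ≠ 0) (he : h.natDegree ≤ e) :
    (∃ q, h = lin u v * q ∧ q ≠ 0 ∧ q.natDegree + 1 ≤ e) ∨
    ∃ c0 : Polynomial ℂ, c0.natDegree + e ≤ M ∧ ∀ c : Polynomial ℂ, c.natDegree ≤ M →
      ∃ (α : ℂ) (q : Polynomial ℂ), c = lin u v * q + α • (h * c0) ∧ (q = 0 ∨ q.natDegree + 1 ≤ M) := by
  obtain ⟨ev, hdiv, hc0⟩ := ev_exists hnz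
  by_cases hev : ev e h = 0
  · left
    obtain ⟨q, hq, hq2⟩ := hdiv e h he hev
    have hq0 : q ≠ 0 := by rintro rfl; exact h0 (by simpa using hq)
    exact ⟨q, hq, hq0, hq2.resolve_left hq0⟩
  · right
    obtain ⟨c0, hd0, hev0⟩ := hc0 e M heM
    refine ⟨c0, hd0, fun c hc => ?_⟩
    have hdeg : (h * c0).natDegree ≤ M := (Polynomial.natDegree_mul_le).trans (by omega)
    obtain ⟨q, hq, hq2⟩ := hdiv M (c - (ev M c / ev e h) • (h * c0)) 
      ((Polynomial.natDegree_sub_le _ _).trans (max_le hc ((Polynomial.natDegree_smul_le _ _).trans hdeg)))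
      (by rw [map_sub, map_smul, hev0 h he, smul_eq_mul, div_mul_cancel₀ _ hev, sub_self])
    exact ⟨_, q, by rw [← hq, sub_add_cancel], hq2⟩

lemma comb {n : ℕ} (u v : Fin n → ℂ) (hnz : ∀ i, u i ≠ 0 ∨ v i ≠ 0) (s : ℕ) : ∀ (I : Finset (Fin n)), I.card = s →
    ∀ (g : Polynomial ℂ →ₗ[ℂ] ℂ) (N e : ℕ) (h : Polynomial ℂ), h ≠ 0 → h.natDegree ≤ e → e + s ≤ N + 1 →
    (∀ c : Polynomial ℂ, c.natDegree + s ≤ N → g ((∏ i ∈ I, lin (u i) (v i)) * c) = 0) →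
    (∀ c : Polynomial ℂ, c.natDegree + e ≤ N → g (h * c) = 0) →
    ∃ J ⊆ I, J.card ≤ e ∧ ∀ c : Polynomial ℂ, c.natDegree + J.card ≤ N → g ((∏ i ∈ J, lin (u i) (v i)) * c) = 0 := by
  induction s with
  | zero =>
    intro I hI g N e h h0 he hN hP _
    refine ⟨I, subset_rfl, by omega, ?_⟩
    rwa [hI]
  | succ s ih =>
    intro I hI g N e h h0 he hN hP hh
    by_cases hse : s + 1 ≤ e
    · refine ⟨I, subset_rfl, by omega, ?_⟩
      rwa [hI]
    obtain ⟨i, hi⟩ : I.Nonempty := Finset.card_pos.1 (by omega)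
    have hcard : (I.erase i).card = s := by rw [Finset.card_erase_of_mem hi, hI]; rfl
    have hprod := Finset.mul_prod_erase I (fun i => lin (u i) (v i)) hi
    have hpd : (∏ x ∈ I.erase i, lin (u x) (v x)).natDegree ≤ s := by
      refine (Polynomial.natDegree_prod_le _ _).trans ?_
      refine (Finset.sum_le_card_nsmul _ _ 1 fun x _ => natDegree_lin_le _ _).trans ?_
      simp [hcard]
    rcases div_or (hnz i) (M := N - s) (by omega) h h0 he with ⟨q, hq, hq0, hqe⟩ | ⟨c0, hc0, hc⟩
    · obtain ⟨J, hJI, hJe, hJ⟩ := ih (I.erase i) hcard (g ∘ₗ LinearMap.mulLeft ℂ (lin (u i) (v i))) (N - 1) (e - 1) q hq0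
        (by omega) (by omega) (by
          intro c hc
          rw [LinearMap.comp_apply, LinearMap.mulLeft_apply, ← mul_assoc, hprod]
          exact hP c (by omega)) (by
          intro c hc
          rw [LinearMap.comp_apply, LinearMap.mulLeft_apply, ← mul_assoc, ← hq]
          exact hh c (by omega))
      have hiJ : i ∉ J := fun hiJ => by simpa using hJI hiJ
      refine ⟨insert i J, ?_, ?_, ?_⟩
      · exact Finset.insert_subset hi (hJI.trans (Finset.erase_subset _ _))
      · rw [Finset.card_insert_of_notMem hiJ]; omega
      · intro c hc
        rw [Finset.card_insert_of_notMem hiJ] at hc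
        have := hJ c (by omega)
        rw [Finset.prod_insert hiJ]
        rwa [LinearMap.comp_apply, LinearMap.mulLeft_apply, ← mul_assoc] at this
    · obtain ⟨J, hJI, hJe, hJ⟩ := ih (I.erase i) hcard g N e h h0 he (by omega) (by
        intro c hcd
        obtain ⟨α, q, rfl, hq⟩ := hc c (by omega)
        rw [mul_add, map_add, mul_smul_comm, map_smul]
        have h1 : g ((∏ x ∈ I.erase i, lin (u x) (v x)) * (lin (u i) (v i) * q)) = 0 := by
          rw [← mul_assoc, mul_comm _ (lin (u i) (v i)), hprod]
          rcases hq with rfl | hq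
          · simp
          · exact hP q (by omega)
        have h2 : g ((∏ x ∈ I.erase i, lin (u x) (v x)) * (h * c0)) = 0 := by
          rw [mul_left_comm]
          refine hh _ ?_
          have := Polynomial.natDegree_mul_le (p := ∏ x ∈ I.erase i, lin (u x) (v x)) (q := c0)
          omega
        rw [h1, h2, smul_zero, add_zero]) hh
      exact ⟨J, hJI.trans (Finset.erase_subset _ _), hJe, hJ⟩

/-- first part of claim A -/
lemma exists_h {d r n N : ℕ} (hd : r ≤ d) (hN : d - r = N) (a : Fin (d+1) → ℂ) (G : Polynomial ℂ) (hG : G.natDegree + n ≤ r)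
    (hW : Submodule.span ℂ (apolarSet d r a) ⊔ LinearMap.range (mulMap r n G) ≠ ⊤) :
    ∃ h : Polynomial ℂ, h ≠ 0 ∧ h.natDegree ≤ N ∧ ∀ c : Polynomial ℂ, c.natDegree ≤ n → Lf d a (G * (h * c)) = 0 := by
  obtain ⟨φ, hφ, hle⟩ := Submodule.exists_le_ker_of_lt_top _ (lt_top_iff_ne_top.2 hW)
  let κ : (Fin (r+1) → ℂ) →ₗ[ℂ] (Fin (N+1) → ℂ) :=
    LinearMap.pi fun m => Lf d a ∘ₗ LinearMap.mulRight ℂ (Polynomial.X ^ (m : ℕ)) ∘ₗ polL r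
  have hκ : ∀ b m, κ b m = Lf d a (pol b * Polynomial.X ^ (m : ℕ)) := fun b m => rfl
  have hker : LinearMap.ker κ ≤ LinearMap.ker φ := by
    intro b hb
    apply hle
    apply Submodule.mem_sup_left
    apply Submodule.subset_span
    rw [mem_apolarSet_iff' hd]
    intro c hc
    refine Lf_mul_sum a _ c N (by omega) fun m hm => ?_
    rw [← hκ b ⟨m, by omega⟩, LinearMap.mem_ker.1 hb]; rfl
  have : φ ∈ LinearMap.range κ.dualMap := by
    rw [LinearMap.range_dualMap_eq_dualAnnihilator_ker, Submodule.mem_dualAnnihilator]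
    exact fun w hw => hker hw
  obtain ⟨ψ, hψ⟩ := this
  have hφ' : ∀ b, φ b = Lf d a (pol b * pol (fun m : Fin (N+1) => ψ (Pi.single m 1))) := by
    intro b
    rw [← hψ, LinearMap.dualMap_apply, mul_comm, Lf_pol_mul]
    conv_lhs => rw [LinearMap.pi_apply_eq_sum_univ ψ (κ b)]
    refine Finset.sum_congr rfl fun m _ => ?_
    rw [hκ, smul_eq_mul, mul_comm, mul_comm (pol b)]
    congr 2
    congr 1
    funext x
    simp [Pi.single_apply, eq_comm]
  refine ⟨pol (fun m : Fin (N+1) => ψ (Pi.single m 1)), ?_, natDegree_pol_le _, ?_⟩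
  · intro h0
    apply hφ
    ext b
    simp [hφ', h0]
  · intro c hc
    have h1 : vec r (G * c) ∈ LinearMap.ker φ := by
      apply hle
      apply Submodule.mem_sup_right
      exact ⟨vec n c, by rw [mulMap_apply, pol_vec hc]⟩
    rw [LinearMap.mem_ker, hφ', pol_vec (natDegree_mul_le_of hG hc)] at h1
    rw [← h1]
    congr 1
    ring

lemma prodL_add {n : ℕ} (J : Finset (Fin n)) (lam : Fin n → ℕ) (u v : Fin n → ℂ) :
    prodL lam u v * ∏ i ∈ J, lin (u i) (v i) = prodL (fun i => lam i + if i ∈ J then 1 else 0) u v := by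
  have : ∏ i ∈ J, lin (u i) (v i) = ∏ i, lin (u i) (v i) ^ (if i ∈ J then 1 else 0) := by
    rw [← Finset.prod_subset (Finset.subset_univ J) (fun x _ hx => by simp [hx])]
    exact Finset.prod_congr rfl fun i hi => by simp [hi]
  rw [this, prodL, prodL, ← Finset.prod_mul_distrib]
  exact Finset.prod_congr rfl fun i _ => (pow_add _ _ _).symm

lemma claimA {d r n j : ℕ} {lam : Fin n → ℕ} (hl : ∑ i, lam i = r) (h1 : ∀ i, 1 ≤ lam i) (hjn : j ≤ n) (hd : d + j = r + n)
    (a : Fin (d+1) → ℂ) (u v : Fin n → ℂ) (hnz : ∀ i, u i ≠ 0 ∨ v i ≠ 0)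
    (hx : vec r (prodL lam u v) ∈ apolarSet d r a)
    (hW : Submodule.span ℂ (apolarSet d r a) ⊔ LinearMap.range (mulMap r n (prodL (fun i => lam i - 1) u v)) ≠ ⊤) :
    ∃ ι : Fin n → ℕ, (∀ i, ι i ≤ 1) ∧ ∑ i, ι i = j ∧
      ∀ c : Polynomial ℂ, c.natDegree ≤ n → Lf d a (prodL (fun i => lam i - ι i) u v * c) = 0 := by
  obtain ⟨h, h0, hdeg, hh⟩ := exists_h (N := n - j) (by omega) (by omega) a _ (natDegree_G hl h1 u v) hW
  have hlam : (fun i => lam i - 1 + if i ∈ (Finset.univ : Finset (Fin n)) then 1 else 0) = lam := by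
    funext i; have := h1 i; simp; omega
  rw [mem_apolarSet_iff' (by omega), pol_vec ((natDegree_prodL_le _ _ _).trans hl.le)] at hx
  obtain ⟨J0, -, hJ0c, hJ0⟩ := comb u v hnz n Finset.univ (by simp)
    (Lf d a ∘ₗ LinearMap.mulLeft ℂ (prodL (fun i => lam i - 1) u v)) (2 * n - j) (n - j) h h0 hdeg (by omega) (by
      intro c hc
      rw [LinearMap.comp_apply, LinearMap.mulLeft_apply, ← mul_assoc, prodL_add, hlam]
      exact hx c (by omega)) (by
      intro c hc
      rw [LinearMap.comp_apply, LinearMap.mulLeft_apply]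
      exact hh c (by omega))
  obtain ⟨J, hJJ, hJc⟩ := Finset.exists_superset_card_eq hJ0c (by simp)
  refine ⟨fun i => if i ∈ J then 0 else 1, fun i => by dsimp only; split_ifs <;> simp, ?_, ?_⟩
  · have h2 : ∑ i, (if i ∈ J then 0 else 1) = (Finset.univ.filter fun i => i ∉ J).card := by
      rw [Finset.card_filter]
      exact Finset.sum_congr rfl fun i _ => by split_ifs <;> simp_all
    have h3 : (Finset.univ.filter fun i => i ∉ J) = Jᶜ := by ext; simp
    rw [h2, h3, Finset.card_compl, Fintype.card_fin, hJc]
    omega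
  · intro c hc
    have h4 : prodL (fun i => lam i - if i ∈ J then 0 else 1) u v =
        prodL (fun i => lam i - 1) u v * ∏ i ∈ J, lin (u i) (v i) := by
      rw [prodL_add]
      congr 1
      funext i
      have := h1 i
      split_ifs <;> omega
    have h5 := Finset.prod_sdiff (f := fun i => lin (u i) (v i)) hJJ
    have hdd : (∏ x ∈ J \ J0, lin (u x) (v x)).natDegree ≤ (J \ J0).card := by
      refine (Polynomial.natDegree_prod_le _ _).trans ?_
      refine (Finset.sum_le_card_nsmul _ _ 1 fun x _ => natDegree_lin_le _ _).trans ?_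
      simp
    have hcs := Finset.card_sdiff_add_card_eq_card hJJ
    have := hJ0 ((∏ x ∈ J \ J0, lin (u x) (v x)) * c) (by
      have := Polynomial.natDegree_mul_le (p := ∏ x ∈ J \ J0, lin (u x) (v x)) (q := c)
      omega)
    rw [LinearMap.comp_apply, LinearMap.mulLeft_apply] at this
    rw [h4, ← this, ← h5]
    congr 1
    ring

lemma swap {n j : ℕ} {lam : Fin n → ℕ} (h1 : ∀ i, 1 ≤ lam i) (hjm : j + multOf lam 1 ≤ n) (b : ℕ) :
    ∀ (ι : Fin n → ℕ) (u v : Fin n → ℂ), (Finset.univ.filter fun i => lam i - ι i = 0).card = b →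
    (∀ i, ι i ≤ 1) → ∑ i, ι i = j → (∀ i, u i ≠ 0 ∨ v i ≠ 0) →
    ∃ (ι' : Fin n → ℕ) (u' v' : Fin n → ℂ), (∀ i, ι' i ≤ 1) ∧ ∑ i, ι' i = j ∧ (∀ i, 1 ≤ lam i - ι' i) ∧
      (∀ i, u' i ≠ 0 ∨ v' i ≠ 0) ∧
      prodL (fun i => lam i - ι' i) u' v' = prodL (fun i => lam i - ι i) u v := by
  induction b with
  | zero =>
    intro ι u v hb hι hs hnz
    refine ⟨ι, u, v, hι, hs, ?_, hnz, rfl⟩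
    intro i
    by_contra hi
    have : i ∈ (Finset.univ.filter fun i => lam i - ι i = 0) := by simp; omega
    rw [Finset.card_eq_zero.1 hb] at this
    simp at this
  | succ b ih =>
    intro ι u v hb hι hs hnz
    obtain ⟨i, hi⟩ : (Finset.univ.filter fun i => lam i - ι i = 0).Nonempty := Finset.card_pos.1 (by omega)
    simp only [Finset.mem_filter, Finset.mem_univ, true_and] at hi
    have hli : lam i = 1 ∧ ι i = 1 := by have := h1 i; have := hι i; omega
    obtain ⟨p, hp0, hp2⟩ : ∃ p, ι p = 0 ∧ 2 ≤ lam p := by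
      by_contra hcon
      push Not at hcon
      have hsub : (Finset.univ.filter fun p => ι p = 0) ⊂ Finset.univ.filter fun p => lam p = 1 := by
        rw [Finset.ssubset_iff_of_subset]
        · exact ⟨i, by simp [hli.1], by simp [hli.2]⟩
        · intro p hp
          simp only [Finset.mem_filter, Finset.mem_univ, true_and] at hp ⊢
          have := hcon p hp; have := h1 p; omega
      have hlt := Finset.card_lt_card hsub
      have h0 : (Finset.univ.filter fun p => ι p = 0).card + ∑ p, ι p = n := by
        rw [Finset.card_filter, ← Finset.sum_add_distrib]
        have : ∀ p ∈ (Finset.univ : Finset (Fin n)), (if ι p = 0 then 1 else 0) + ι p = 1 := by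
          intro p _; have := hι p; split_ifs <;> omega
        rw [Finset.sum_congr rfl this]; simp
      unfold multOf at hjm
      omega
    have hip : p ≠ i := by rintro rfl; omega
    let ι2 : Fin n → ℕ := Function.update (Function.update ι i 0) p 1
    have e1 : ι2 i = 0 := by simp [ι2, Function.update_of_ne hip.symm]
    have e2 : ι2 p = 1 := by simp [ι2]
    have e3 : ∀ x, x ≠ i → x ≠ p → ι2 x = ι x := fun x hx hx' => by
      simp [ι2, Function.update_of_ne hx, Function.update_of_ne hx']
    let u2 := Function.update u i (u p)
    let v2 := Function.update v i (v p)
    have hpi : p ∈ Finset.univ.erase i := by simp [hip]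
    obtain ⟨ι', u', v', a1, a2, a3, a4, a5⟩ := ih ι2 u2 v2 (by
        have : (Finset.univ.filter fun x => lam x - ι2 x = 0) = (Finset.univ.filter fun x => lam x - ι x = 0).erase i := by
          ext x
          simp only [Finset.mem_filter, Finset.mem_univ, true_and, Finset.mem_erase]
          by_cases hx : x = i
          · subst hx; simp [e1]; omega
          · by_cases hx' : x = p
            · subst hx'; simp [e2, hx, hp0]; omega
            · simp [e3 x hx hx', hx]
        rw [this, Finset.card_erase_of_mem (by simp; omega), hb]; rfl)
      (by
        intro x
        by_cases hx : x = i
        · subst hx; omega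
        · by_cases hx' : x = p
          · subst hx'; omega
          · rw [e3 x hx hx']; exact hι x)
      (by
        rw [← hs, ← Finset.add_sum_erase _ _ (Finset.mem_univ i), ← Finset.add_sum_erase _ _ hpi,
          ← Finset.add_sum_erase _ ι (Finset.mem_univ i), ← Finset.add_sum_erase _ ι hpi, e1, e2, hli.2, hp0]
        rw [Finset.sum_congr rfl fun x hx => e3 x (by simp at hx; tauto) (by simp at hx; tauto)]
        exact Nat.add_left_comm 0 1 _)
      (by
        intro x
        by_cases hx : x = i
        · subst hx; simpa [u2, v2] using hnz p
        · simpa [u2, v2, Function.update_of_ne hx] using hnz x)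
    refine ⟨ι', u', v', a1, a2, a3, a4, a5.trans ?_⟩
    rw [prodL, prodL, ← Finset.mul_prod_erase _ _ (Finset.mem_univ i), ← Finset.mul_prod_erase _ _ hpi,
      ← Finset.mul_prod_erase Finset.univ (fun x => lin (u x) (v x) ^ (lam x - ι x)) (Finset.mem_univ i),
      ← Finset.mul_prod_erase _ (fun x => lin (u x) (v x) ^ (lam x - ι x)) hpi]
    have hrest : ∏ x ∈ (Finset.univ.erase i).erase p, lin (u2 x) (v2 x) ^ (lam x - ι2 x) =
        ∏ x ∈ (Finset.univ.erase i).erase p, lin (u x) (v x) ^ (lam x - ι x) := by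
      refine Finset.prod_congr rfl fun x hx => ?_
      simp only [Finset.mem_erase, Finset.mem_univ, and_true] at hx
      rw [e3 x hx.2 hx.1]
      simp [u2, v2, Function.update_of_ne hx.2]
    rw [hrest, ← mul_assoc, ← mul_assoc]
    congr 1
    simp only [e1, e2, hli.1, hli.2, hp0, u2, v2, Function.update_self, Function.update_of_ne hip]
    have : lam p = (lam p - 1) + 1 := by omega
    simp only [Nat.sub_zero, Nat.sub_self, pow_zero, one_mul, pow_one]
    conv_rhs => rw [this, pow_succ']

lemma subset_zC {σ : Type} [Fintype σ] [DecidableEq σ] (S : Set (σ → ℂ)) : S ⊆ zClosure S :=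
  fun x hx _ hp => hp x hx

lemma zC_min {σ : Type} [Fintype σ] [DecidableEq σ] {S T : Set (σ → ℂ)} (h : S ⊆ zClosure T) : zClosure S ⊆ zClosure T :=
  fun _ hx p hp => hx p fun y hy => h hy p hp

lemma zC_union {σ τ : Type} [Fintype σ] [DecidableEq σ] {I : Set τ} (hI : I.Finite) (S : τ → Set (σ → ℂ)) :
    zClosure (⋃ i ∈ I, zClosure (S i)) ⊆ ⋃ i ∈ I, zClosure (S i) := by
  intro x hx
  by_contra hcon
  simp only [Set.mem_iUnion, not_exists] at hcon
  have : ∀ i, ∃ p : MvPolynomial σ ℂ, i ∈ I → (∀ y ∈ S i, eval y p = 0) ∧ eval x p ≠ 0 := by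
    intro i
    by_cases hi : i ∈ I
    · have := hcon i hi
      simp only [zClosure, Set.mem_setOf_eq, not_forall] at this
      obtain ⟨p, hp, hne⟩ := this
      exact ⟨p, fun _ => ⟨hp, hne⟩⟩
    · exact ⟨0, fun h => absurd h hi⟩
  choose p hp using this
  have h0 := hx (∏ i ∈ hI.toFinset, p i) (by
    intro y hy
    simp only [Set.mem_iUnion] at hy
    obtain ⟨i, hi, hy⟩ := hy
    rw [map_prod]
    exact Finset.prod_eq_zero (hI.mem_toFinset.2 hi) (hy _ (hp i hi).1))
  rw [map_prod, Finset.prod_eq_zero_iff] at h0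
  obtain ⟨i, hi, h0⟩ := h0
  exact (hp i (hI.mem_toFinset.1 hi)).2 h0

lemma span_apolarSet {d s : ℕ} (hs : s ≤ d) (a : Fin (d+1) → ℂ) {b : Fin (s+1) → ℂ}
    (hb : b ∈ Submodule.span ℂ (apolarSet d s a)) : b ∈ apolarSet d s a := by
  rw [mem_apolarSet_iff' hs]
  induction hb using Submodule.span_induction with
  | mem x hx => exact (mem_apolarSet_iff' hs x a).1 hx
  | zero => intro c _; simp [pol]
  | add x y _ _ hx hy =>
    intro c hc
    have : pol (x + y) = pol x + pol y := (polL s).map_add x y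
    rw [this, add_mul, map_add, hx c hc, hy c hc, add_zero]
  | smul t x _ hx =>
    intro c hc
    have : pol (t • x) = t • pol x := (polL s).map_smul t x
    rw [this, smul_mul_assoc, map_smul, hx c hc, smul_zero]

lemma finrank_apolar {d r M k : ℕ} (hd : d = r + M) (hk : k + M = r) (h : Fin (d+1) → ℂ) (hND : ND d M h) :
    Module.finrank ℂ (Submodule.span ℂ (apolarSet d r h)) = k := by
  let κ : (Fin (r+1) → ℂ) →ₗ[ℂ] (Fin (M+1) → ℂ) :=
    LinearMap.pi fun m => Lf d h ∘ₗ LinearMap.mulRight ℂ (Polynomial.X ^ (m : ℕ)) ∘ₗ polL r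
  have hκ : ∀ b m, κ b m = Lf d h (pol b * Polynomial.X ^ (m : ℕ)) := fun b m => rfl
  have hker : LinearMap.ker κ = Submodule.span ℂ (apolarSet d r h) := by
    apply le_antisymm
    · intro b hb
      apply Submodule.subset_span
      rw [mem_apolarSet_iff' (by omega)]
      intro c hc
      refine Lf_mul_sum h _ c M (by omega) fun m hm => ?_
      rw [← hκ b ⟨m, by omega⟩, LinearMap.mem_ker.1 hb]; rfl
    · intro b hb
      have := span_apolarSet (by omega) h hb
      rw [mem_apolarSet_iff' (by omega)] at this
      rw [LinearMap.mem_ker]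
      funext m
      rw [hκ]
      exact this _ (by rw [Polynomial.natDegree_X_pow]; omega)
  have hsurj : LinearMap.range κ = ⊤ := by
    by_contra hne
    obtain ⟨ψ, hψ, hle⟩ := Submodule.exists_le_ker_of_lt_top _ (lt_top_iff_ne_top.2 hne)
    have hψ' : ∀ b, ψ (κ b) = Lf d h (pol (fun m : Fin (M+1) => ψ (Pi.single m 1)) * pol b) := by
      intro b
      rw [Lf_pol_mul]
      conv_lhs => rw [LinearMap.pi_apply_eq_sum_univ ψ (κ b)]
      refine Finset.sum_congr rfl fun m _ => ?_
      rw [hκ, smul_eq_mul, mul_comm, mul_comm (pol b)]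
      congr 2
      congr 1
      funext x
      simp [Pi.single_apply, eq_comm]
    have hp0 : pol (fun m : Fin (M+1) => ψ (Pi.single m 1)) ≠ 0 := by
      intro h0
      apply hψ
      have hz : (fun m : Fin (M+1) => ψ (Pi.single m 1)) = 0 := by
        rw [← vec_pol (fun m : Fin (M+1) => ψ (Pi.single m 1)), h0]; rfl
      apply LinearMap.pi_ext'
      intro m
      ext
      simpa using congrFun hz m
    obtain ⟨s, hs, hne⟩ := hND _ hp0 (natDegree_pol_le _)
    apply hne
    have := hψ' (vec r s)
    rw [pol_vec (by omega)] at this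
    rw [← this]
    exact hle ⟨_, rfl⟩
  have := LinearMap.finrank_range_add_finrank_ker κ
  rw [hsurj, hker, finrank_top, Module.finrank_fin_fun, Module.finrank_fin_fun] at this
  omega

lemma Lf_zero_left (d : ℕ) (p : Polynomial ℂ) : Lf d 0 p = 0 := by
  rw [Lf_eq]; simp

lemma ND_ne_zero {d M : ℕ} {h : Fin (d+1) → ℂ} (hh : ND d M h) : h ≠ 0 := by
  rintro rfl
  obtain ⟨s, _, hne⟩ := hh 1 one_ne_zero (by simp)
  exact hne (Lf_zero_left _ _)

lemma vec_ne_zero {d : ℕ} {p : Polynomial ℂ} (hp : p.natDegree ≤ d) (h0 : p ≠ 0) : vec d p ≠ 0 := by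
  intro h
  apply h0
  rw [← pol_vec hp, h]
  simp [pol]

lemma sum_mu {r n j : ℕ} {lam ι : Fin n → ℕ} (hl : ∑ i, lam i = r) (hs : ∑ i, ι i = j) (h1 : ∀ i, 1 ≤ lam i - ι i) :
    ∑ i, (lam i - ι i) + j = r := by
  rw [← hl, ← hs, ← Finset.sum_add_distrib]
  exact Finset.sum_congr rfl fun i _ => by have := h1 i; omega

/-- `Q` contains all generic nondegenerate `h` killed by the product -/
lemma dual_gen {d n : ℕ} {κ : Fin n → ℕ} (hn : 0 < n) (hκ : ∑ i, κ i + n = d) (u v : Fin n → ℂ)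
    (h : Fin (d+1) → ℂ) (h0 : h ≠ 0) (hnz : ∀ i, u i ≠ 0 ∨ v i ≠ 0)
    (hdim : zTangentDim (crlCone d n fun i => κ i + 1) (vec d (prodL (fun i => κ i + 1) u v)) = n + 1)
    (hk : ∀ c : Polynomial ℂ, c.natDegree ≤ n → Lf d h (prodL κ u v * c) = 0) :
    h ∈ {h | h ≠ 0 ∧ ∃ a ∈ crlCone d n (fun i => κ i + 1), a ≠ 0 ∧ zTangentDim (crlCone d n fun i => κ i + 1) a = n + 1 ∧
      ∀ v ∈ zTangentAt (crlCone d n fun i => κ i + 1) a, apolarPair d h v = 0} := by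
  have hl : ∑ i, (κ i + 1) = d := by rw [Finset.sum_add_distrib]; simpa using hκ
  have hdeg : (prodL (fun i => κ i + 1) u v).natDegree ≤ d := (natDegree_prodL_le _ _ _).trans hl.le
  have ha0 := vec_ne_zero hdeg (prodL_ne_zero (fun i => κ i + 1) hnz)
  refine ⟨h0, vec d (prodL (fun i => κ i + 1) u v), ?_, ha0, hdim, ?_⟩
  · rw [crl_iff hl]
    exact ⟨1, u, v, by rw [pol_vec hdeg]; simp⟩
  · intro w hw
    have htan := tan_eq hn hl (fun i => by omega) _ 1 u v (by rw [pol_vec hdeg]; simp) ha0 hdim.le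
    have hw' : w ∈ zTanSub (crlCone d n fun i => κ i + 1) (vec d (prodL (fun i => κ i + 1) u v)) := hw
    rw [htan, mem_range_mulMap (natDegree_G hl (fun i => by omega) u v)] at hw'
    obtain ⟨c, hc, hwc⟩ := hw'
    rw [apolarPair_eq, hwc]
    exact hk c hc

lemma dual_gen' {d n : ℕ} {κ : Fin n → ℕ} (hn : 0 < n) (hκ : ∑ i, κ i + n = d) (h : Fin (d+1) → ℂ)
    (hh : h ∈ {h | h ≠ 0 ∧ ∃ a ∈ crlCone d n (fun i => κ i + 1), a ≠ 0 ∧ zTangentDim (crlCone d n fun i => κ i + 1) a = n + 1 ∧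
      ∀ v ∈ zTangentAt (crlCone d n fun i => κ i + 1) a, apolarPair d h v = 0}) :
    ∃ u v : Fin n → ℂ, (∀ i, u i ≠ 0 ∨ v i ≠ 0) ∧ ∀ c : Polynomial ℂ, c.natDegree ≤ n → Lf d h (prodL κ u v * c) = 0 := by
  have hl : ∑ i, (κ i + 1) = d := by rw [Finset.sum_add_distrib]; simpa using hκ
  obtain ⟨-, a, haS, ha0, hdim, hv⟩ := hh
  obtain ⟨t, u, v, hx⟩ := (crl_iff hl a).1 haS
  obtain ⟨ht, hnz⟩ := nz_of_pol (fun i => by omega) a t u v hx ha0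
  refine ⟨u, v, hnz, fun c hc => ?_⟩
  have htan := tan_eq hn hl (fun i => by omega) a t u v hx ha0 hdim.le
  have hG := natDegree_G hl (fun i => by omega) u v
  have hdeg := natDegree_mul_le_of hG hc
  have hmem : vec d (prodL (fun i => κ i + 1 - 1) u v * c) ∈ zTanSub (crlCone d n fun i => κ i + 1) a := by
    rw [htan, mem_range_mulMap hG]
    exact ⟨c, hc, pol_vec hdeg⟩
  have := hv _ hmem
  rw [apolarPair_eq, pol_vec hdeg] at this
  exact this

lemma pull_gen {d r n j k : ℕ} {lam ι : Fin n → ℕ} (hn : 0 < n) (hl : ∑ i, lam i = r) (h1 : ∀ i, 1 ≤ lam i)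
    (hjn : j ≤ n) (hd : d + j = r + n) (hk : k + n = r + j)
    (hι : ∀ i, ι i ≤ 1) (hs : ∑ i, ι i = j) (hι1 : ∀ i, 1 ≤ lam i - ι i)
    (u v : Fin n → ℂ) (h : Fin (d+1) → ℂ) (hnz : ∀ i, u i ≠ 0 ∨ v i ≠ 0)
    (hdim : zTangentDim (crlCone r n lam) (vec r (prodL lam u v)) = n + 1)
    (hkill : ∀ c : Polynomial ℂ, c.natDegree ≤ n → Lf d h (prodL (fun i => lam i - ι i) u v * c) = 0)
    (hND : ND d (n - j) h) :
    h ∈ apolarPull d r k (zClosure (smoothCHCone r (crlCone r n lam) (n+1) k j)) := by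
  have hW := finrank_apolar (r := r) (k := k) (by omega) (by omega) h hND
  set W := Submodule.span ℂ (apolarSet d r h) with hWdef
  have hmemW : ∀ b : Polynomial ℂ, b.natDegree ≤ r → (∀ c : Polynomial ℂ, c.natDegree ≤ n - j → Lf d h (b * c) = 0) →
      vec r b ∈ W := by
    intro b hb hb2
    apply Submodule.subset_span
    rw [mem_apolarSet_iff' (by omega), pol_vec hb]
    intro c hc
    exact hb2 c (by omega)
  let B := Module.finBasisOfFinrankEq ℂ W hW
  let A : Matrix (Fin k) (Fin (r+1)) ℂ := fun i => (B i : Fin (r+1) → ℂ)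
  have hA : rowSpan A = W := by
    have : (Set.range fun i => A i) = W.subtype '' Set.range B := by
      rw [← Set.range_comp]; rfl
    rw [rowSpan, this, Submodule.span_image, B.span_eq, Submodule.map_top, Submodule.range_subtype]
  have hdeg : (prodL lam u v).natDegree ≤ r := (natDegree_prodL_le _ _ _).trans hl.le
  have hx0 := vec_ne_zero hdeg (prodL_ne_zero lam hnz)
  have hadd : ∀ κ κ' : Fin n → ℕ, prodL κ u v * prodL κ' u v = prodL (fun i => κ i + κ' i) u v := by
    intro κ κ'
    rw [prodL, prodL, prodL, ← Finset.prod_mul_distrib]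
    exact Finset.prod_congr rfl fun i _ => (pow_add _ _ _).symm
  have hsum := sum_mu hl hs hι1
  have hdegk : (prodL (fun i => lam i - ι i) u v).natDegree + j ≤ r := by
    have := natDegree_prodL_le (fun i => lam i - ι i) u v
    omega
  refine ⟨A, hA, by rw [hA, hW], subset_zC _ ⟨A, rfl, by rw [hA, hW], vec r (prodL lam u v), hx0, ?_, hdim, ?_, ?_⟩⟩
  · rw [crl_iff hl]
    exact ⟨1, u, v, by rw [pol_vec hdeg]; simp⟩
  · rw [hA]
    apply hmemW _ hdeg
    intro c hc
    have : prodL lam u v = prodL (fun i => lam i - ι i) u v * prodL ι u v := by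
      rw [hadd]
      congr 1
      funext i
      have := hι1 i
      omega
    rw [this, mul_assoc]
    apply hkill
    have h2 := natDegree_prodL_le ι u v
    have := Polynomial.natDegree_mul_le (p := prodL ι u v) (q := c)
    omega
  · rw [hA, span_zTangentAt, tan_eq hn hl h1 _ 1 u v (by rw [pol_vec hdeg]; simp) hx0 hdim.le]
    rw [← finrank_mulMap hdegk (prodL_ne_zero _ hnz)]
    apply Submodule.finrank_mono
    rintro _ ⟨c, rfl⟩
    rw [mulMap_apply]
    have hcd := natDegree_pol_le c
    refine ⟨?_, ?_⟩
    · apply hmemW _ (natDegree_mul_le_of hdegk hcd)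
      intro c' hc'
      rw [mul_assoc]
      apply hkill
      have := Polynomial.natDegree_mul_le (p := pol c) (q := c')
      omega
    · rw [SetLike.mem_coe, mem_range_mulMap (natDegree_G hl h1 u v)]
      refine ⟨prodL (fun i => 1 - ι i) u v * pol c, ?_, ?_⟩
      · have h2 := natDegree_prodL_le (fun i => 1 - ι i) u v
        have h3 : ∑ i, (1 - ι i) + j = n := by
          rw [← hs, ← Finset.sum_add_distrib]
          have : ∀ p ∈ (Finset.univ : Finset (Fin n)), 1 - ι p + ι p = 1 := by
            intro p _; have := hι p; omega
          rw [Finset.sum_congr rfl this]; simp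
        have := Polynomial.natDegree_mul_le (p := prodL (fun i => 1 - ι i) u v) (q := pol c)
        omega
      · rw [pol_vec (natDegree_mul_le_of hdegk hcd), ← mul_assoc, hadd]
        congr 2
        funext i
        have := hι1 i
        have := hι i
        have := h1 i
        omega

/-- for `j ≤ n − m_1(λ)`, set-theoretically the closure of
`Ψ_{d,r}⁻¹(CH_j(Δ_λ))` is the union, over the partitions `λ' = λ − ι ∈ F_j(λ)` (all parts of
`λ−ι` still positive), of the dual varieties `(Δ_{(λ'_1+1,…,λ'_n+1)})^∨`, where
`(λ'_1+1,…,λ'_n+1)` is a partition of `d = r+n−j`. -/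
theorem pullback_CH_union_of_duals (r n j : ℕ) (lam : Fin n → ℕ)
    (hpart : isPartitionOf r n lam) (hjr : j + n + 1 ≤ r)
    (hjm : j + multOf lam 1 ≤ n) :
    zClosure (apolarPull (r + n - j) r (r - n + j)
        (zClosure (smoothCHCone r (crlCone r n lam) (n+1) (r - n + j) j)))
      = ⋃ ι ∈ {ι : Fin n → ℕ |
            (∀ i, ι i ≤ 1) ∧ (∑ i, ι i = j) ∧ ∀ i, 1 ≤ lam i - ι i},
          dualConeOf (r + n - j)
            (crlCone (r + n - j) n fun i => lam i - ι i + 1) (n+1) := by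
  obtain ⟨h1, hl⟩ := hpart
  have hjn : j ≤ n := by omega
  have hn : 0 < n := by
    rcases Nat.eq_zero_or_pos n with rfl | h
    · simp at hl; omega
    · exact h
  have hd : r + n - j + j = r + n := by omega
  have hk : r - n + j + n = r + j := by omega
  generalize r + n - j = d at hd ⊢
  generalize r - n + j = k at hk ⊢
  apply Set.Subset.antisymm
  · have hfin : {ι : Fin n → ℕ | (∀ i, ι i ≤ 1) ∧ (∑ i, ι i = j) ∧ ∀ i, 1 ≤ lam i - ι i}.Finite := by
      apply Set.Finite.subset (Set.Finite.pi (fun _ : Fin n => Set.finite_Iic 1))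
      intro ι hι i _
      exact hι.1 i
    unfold dualConeOf
    refine Set.Subset.trans ?_ (zC_union hfin _)
    apply zC_min
    refine Set.Subset.trans ?_ (subset_zC _)
    rintro a ⟨M, hM, hMk, hMC⟩
    obtain ⟨u, v, hnz, hx, hT⟩ := CH_decode (m := n - j + 1) hn hl h1 (by omega) hk M hMk hMC
    rw [hM] at hx hT
    obtain ⟨ι0, h0a, h0b, h0c⟩ := claimA hl h1 hjn hd a u v hnz (span_apolarSet (by omega) a hx) hT
    obtain ⟨ι, u', v', ha, hb, hc, hnz', hprod⟩ := swap h1 hjm _ ι0 u v rfl h0a h0b hnz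
    rw [← hprod] at h0c
    have hsum := sum_mu hl hb hc
    simp only [Set.mem_iUnion]
    refine ⟨ι, ⟨ha, hb, hc⟩, ?_⟩
    obtain ⟨D, hD1, hD2⟩ := generic_smooth (r := d) (lam := fun i => lam i - ι i + 1) hn
      (by rw [Finset.sum_add_distrib]; simp; omega) (fun i => by omega)
    refine density (d := d) (e := r - j) (n := n) (M := n - j) (by omega) (by omega) (by omega)
      (fun i => lam i - ι i) (by omega) D hD1 _ ?_ u' v' a hnz' h0c
    intro u v h hv hD hkill hND
    exact dual_gen (κ := fun i => lam i - ι i) hn (by omega) u v h (ND_ne_zero hND) (fun i => Or.inr (hv i)) (hD2 u v hv hD) hkill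
  · intro x hx
    simp only [Set.mem_iUnion] at hx
    obtain ⟨ι, ⟨ha, hb, hc⟩, hx⟩ := hx
    have hsum := sum_mu hl hb hc
    refine zC_min ?_ hx
    intro h hh
    obtain ⟨u, v, hnz, hkill⟩ := dual_gen' (κ := fun i => lam i - ι i) hn (by omega) h hh
    obtain ⟨D, hD1, hD2⟩ := generic_smooth (r := r) (lam := lam) hn hl h1
    refine density (d := d) (e := r - j) (n := n) (M := n - j) (by omega) (by omega) (by omega)
      (fun i => lam i - ι i) (by omega) D hD1 _ ?_ u v h hnz hkill
    intro u v h hv hD hkill hND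
    exact pull_gen hn hl h1 hjn hd hk ha hb hc u v h (fun i => Or.inr (hv i)) (hD2 u v hv hD) hkill hND
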